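/- Arbitrarily varying null versus composite i.i.d. alternative. Let ℋ = ℂ^d be a finite-dimensional Hilbert space and 𝒜₁, ℬ₁ ⊆ 𝒟(ℋ) two non-empty closed sets of states. Then Stein(𝒜₁^{av}‖ℬ₁^{iid}) = min*_{μ∈𝒫(ℬ₁)} lim_{n→∞} (1/n) inf_{ρ_n ∈ co(𝒜₁^{⊗n,av})} D(ρ_n ‖ ∫_{ℬ₁} dμ(σ) σ^{⊗n}), where the minimum is restricted to those μ for which the inner limit in n exists (a non-empty set on which the minimum is attained). -/

import Mathlib

open Filter MeasureTheory Topology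
open scoped BigOperators Classical ComplexOrder

noncomputable section

namespace QSanov

/-- Matrices representing operators on the single-copy Hilbert space with orthonormal
basis indexed by `ι`. -/
abbrev MatC (ι : Type*) := Matrix ι ι ℂ

/-- Matrices representing operators on the `n`-fold tensor power Hilbert space. -/
abbrev MatN (ι : Type*) (n : ℕ) := Matrix (Fin n → ι) (Fin n → ι) ℂ

instance matMeasurableSpace (m n : Type*) : MeasurableSpace (Matrix m n ℂ) :=
  inferInstanceAs (MeasurableSpace (m → n → ℂ))

/-- A quantum state: a positive semidefinite matrix of trace one. -/
def IsState {κ : Type*} [Fintype κ] (ρ : Matrix κ κ ℂ) : Prop :=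
  ρ.PosSemidef ∧ ρ.trace = 1

/-- Loewner order: `A ≤ B` iff `B - A` is positive semidefinite. -/
def loewnerLE {κ : Type*} [Fintype κ] (A B : Matrix κ κ ℂ) : Prop :=
  (B - A).PosSemidef

/-- The `n`-fold tensor power `ρ^{⊗n}` of a single-copy matrix. -/
def tensorPow {ι : Type*} (ρ : MatC ι) (n : ℕ) : MatN ι n :=
  fun i j => ∏ k, ρ (i k) (j k)

/-- The tensor product `ρ₁ ⊗ ⋯ ⊗ ρ_n` of a family of single-copy matrices. -/
def tensorProdFam {ι : Type*} {n : ℕ} (ρ : Fin n → MatC ι) : MatN ι n :=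
  fun i j => ∏ k, ρ k (i k) (j k)

/-- The tensor product of an `n`-copy matrix and an `m`-copy matrix. -/
def tensorMul {ι : Type*} {n m : ℕ} (ρ : MatN ι n) (σ : MatN ι m) : MatN ι (n + m) :=
  fun i j => ρ (fun t => i (Fin.castAdd m t)) (fun t => j (Fin.castAdd m t)) *
    σ (fun t => i (Fin.natAdd n t)) (fun t => j (Fin.natAdd n t))

/-- Conjugation `U_π ρ U_π†` by the unitary permuting the `n` tensor factors. -/
def permCopies {ι : Type*} {n : ℕ} (π : Equiv.Perm (Fin n)) (ρ : MatN ι n) : MatN ι n :=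
  fun i j => ρ (i ∘ π) (j ∘ π)

/-- Matrix logarithm via functional calculus on the support (eigenvalue `0` is sent
to `0`, since `Real.log 0 = 0`). -/
def matLog {κ : Type*} [Fintype κ] [DecidableEq κ] (A : Matrix κ κ ℂ) : Matrix κ κ ℂ :=
  if hA : A.IsHermitian then
    (hA.eigenvectorUnitary : Matrix κ κ ℂ) *
      (Matrix.diagonal fun i => (Real.log (hA.eigenvalues i) : ℂ)) *
      (star (hA.eigenvectorUnitary : Matrix κ κ ℂ))
  else 0

/-- Support inclusion `supp ρ ⊆ supp σ`, phrased as inclusion of ranges. -/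
def suppLE {κ : Type*} [Fintype κ] [DecidableEq κ] (ρ σ : Matrix κ κ ℂ) : Prop :=
  LinearMap.range (Matrix.toLin' ρ) ≤ LinearMap.range (Matrix.toLin' σ)

/-- Umegaki relative entropy `D(ρ‖σ) = Tr[ρ (log ρ - log σ)]`, equal to `+∞` when
`supp ρ ⊄ supp σ`. -/
def relEnt {κ : Type*} [Fintype κ] [DecidableEq κ] (ρ σ : Matrix κ κ ℂ) : EReal :=
  if suppLE ρ σ then (((ρ * (matLog ρ - matLog σ)).trace.re : ℝ) : EReal) else ⊤

/-- Relative entropy between two sets of states: `D(𝒜‖ℬ) = inf_{ρ∈𝒜, σ∈ℬ} D(ρ‖σ)`. -/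
def relEntSet {κ : Type*} [Fintype κ] [DecidableEq κ] (A B : Set (Matrix κ κ ℂ)) : EReal :=
  ⨅ ρ ∈ A, ⨅ σ ∈ B, relEnt ρ σ

/-- The composite i.i.d. hypothesis `𝒻₁^{⊗n, iid}` built on the base set `F1`. -/
def iidSet {ι : Type*} (F1 : Set (MatC ι)) (n : ℕ) : Set (MatN ι n) :=
  {ρ | ∃ σ ∈ F1, ρ = tensorPow σ n}

/-- The arbitrarily varying hypothesis `𝒻₁^{⊗n, av}` built on the base set `F1`. -/
def avSet {ι : Type*} (F1 : Set (MatC ι)) (n : ℕ) : Set (MatN ι n) :=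
  {ρ | ∃ f : Fin n → MatC ι, (∀ p, f p ∈ F1) ∧ ρ = tensorProdFam f}

/-- Worst-case type II error probability `β_ε(A‖B)` for a threshold `ε` on the
worst-case type I error probability. -/
def typeII {κ : Type*} [Fintype κ] [DecidableEq κ] (A B : Set (Matrix κ κ ℂ)) (ε : ℝ) : ℝ :=
  sInf {b : ℝ | ∃ E : Matrix κ κ ℂ, E.PosSemidef ∧ (1 - E).PosSemidef ∧
    (∀ ρ ∈ A, (ρ * (1 - E)).trace.re ≤ ε) ∧
    b = sSup {x : ℝ | ∃ σ ∈ B, x = (σ * E).trace.re}}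

/-- `- log x`, with value `+∞` for `x ≤ 0`. -/
def negLog (x : ℝ) : EReal := if x ≤ 0 then ⊤ else ((-Real.log x : ℝ) : EReal)

/-- `(1/n : EReal)`. -/
def cFrac (n : ℕ) : EReal := (((n : ℝ)⁻¹ : ℝ) : EReal)

/-- The Stein exponent `Stein(𝒜‖ℬ) = lim_{ε→0⁺} liminf_n -(1/n) log β_ε(𝒜_n‖ℬ_n)`;
since the inner quantity is monotone nondecreasing in `ε`, the limit as `ε → 0⁺`
coincides with the infimum over `ε ∈ (0,1)`. -/
def steinExponent {ι : Type*} [Fintype ι] [DecidableEq ι]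
    (A B : ∀ n : ℕ, Set (MatN ι n)) : EReal :=
  ⨅ ε ∈ Set.Ioo (0 : ℝ) 1,
    Filter.liminf (fun n : ℕ => cFrac n * negLog (typeII (A n) (B n) ε)) Filter.atTop

/-- The mixture `∫ dμ(σ) σ^{⊗n}` of i.i.d. states along a measure `μ` on a set of
states `C` (Bochner integral, computed entrywise). -/
def iidMix {ι : Type*} {C : Set (MatC ι)} (μ : Measure ↥C) (n : ℕ) : MatN ι n :=
  fun i j => ∫ σ, (∏ k, (σ : MatC ι) (i k) (j k)) ∂μ

/-- The `b`-th block of size `k` of an index of `ℋ^{⊗ mk}`. -/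
def blockOf {ι : Type*} {m k : ℕ} (i : Fin (m * k) → ι) (b : Fin m) : Fin k → ι :=
  fun t => i (finProdFinEquiv (b, t))

/-- Replace the blocks in `S` of the index `i` by the values prescribed by `c`. -/
def mergeBlocks {ι : Type*} {m k : ℕ} (S : Finset (Fin m)) (c : Fin m → Fin k → ι)
    (i : Fin (m * k) → ι) : Fin (m * k) → ι :=
  fun p => if (finProdFinEquiv.symm p).1 ∈ S
    then c (finProdFinEquiv.symm p).1 (finProdFinEquiv.symm p).2 else i p

/-- Entry `(i,j)` of the partial trace of `ρ` over the blocks in `S`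
(the remaining blocks being evaluated at `i`, `j`). -/
def blockPartialTrace {ι : Type*} [Fintype ι] {m k : ℕ} (S : Finset (Fin m))
    (ρ : MatN ι (m * k)) (i j : Fin (m * k) → ι) : ℂ :=
  (((Fintype.card ι : ℂ) ^ (k * (m - S.card)))⁻¹) *
    ∑ c : Fin m → Fin k → ι, ρ (mergeBlocks S c i) (mergeBlocks S c j)

/-- The `m`-fold tensor power `(𝒩^δ_ω)^{⊗ m}` of the depolarising channel
`𝒩^δ_ω(X) = (1-δ) X + δ Tr[X] ω`, acting blockwise on blocks of `k` tensor factors. -/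
def blockDepolarize {ι : Type*} [Fintype ι] (δ : ℝ) {k : ℕ} (ω : MatN ι k) (m : ℕ)
    (ρ : MatN ι (m * k)) : MatN ι (m * k) :=
  fun i j => ∑ S : Finset (Fin m),
    (((1 - δ) ^ (m - S.card) * δ ^ S.card : ℝ) : ℂ) *
      ((∏ b ∈ S, ω (blockOf i b) (blockOf j b)) * blockPartialTrace S ρ i j)

/-- The `m`-fold tensor power of a `k`-copy matrix, as an `mk`-copy matrix. -/
def powBlocks {ι : Type*} {k : ℕ} (ρ : MatN ι k) (m : ℕ) : MatN ι (m * k) :=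
  fun i j => ∏ b : Fin m, ρ (blockOf i b) (blockOf j b)

/-- `Tr_{n+1,…,n+k}[ρ (𝟙^{⊗n} ⊗ F)]`, the filtered reduction of an `(n+k)`-copy matrix. -/
def condReduce {ι : Type*} [Fintype ι] {n k : ℕ} (ρ : MatN ι (n + k)) (F : MatN ι k) :
    MatN ι n :=
  fun i j => ∑ a : Fin k → ι, ∑ b : Fin k → ι,
    ρ (Fin.append i a) (Fin.append j b) * F b a

/-- Partial trace over the `k`-th tensor factor. -/
def traceOutAt {ι : Type*} [Fintype ι] {n : ℕ} (k : Fin (n + 1)) (σ : MatN ι (n + 1)) :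
    MatN ι n :=
  fun i j => ∑ a : ι, σ (k.insertNth a i) (k.insertNth a j)

/-- Insert the single-copy state `τ` at position `k` into an `n`-copy matrix. -/
def insertState {ι : Type*} {n : ℕ} (k : Fin (n + 1)) (τ : MatC ι) (σ : MatN ι n) :
    MatN ι (n + 1) :=
  fun i j => τ (i k) (j k) *
    σ (fun t => i (k.succAbove t)) (fun t => j (k.succAbove t))

/-- Product of a state on `A^n` and a state on `B^n`, viewed as a state on
`(ℋ_A ⊗ ℋ_B)^{⊗ n}` (reordering tensor factors implicitly). -/
def prodStateAB {ιA ιB : Type*} {n : ℕ} (α : Matrix (Fin n → ιA) (Fin n → ιA) ℂ)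
    (β : Matrix (Fin n → ιB) (Fin n → ιB) ℂ) : MatN (ιA × ιB) n :=
  fun i j => α (fun k => (i k).1) (fun k => (j k).1) * β (fun k => (i k).2) (fun k => (j k).2)


/-- The set `𝒮_{A^n:B^n}` of separable states across the cut `A^n : B^n`. -/
def sepSet (ιA ιB : Type*) [Fintype ιA] [Fintype ιB] (n : ℕ) : Set (MatN (ιA × ιB) n) :=
  convexHull ℝ {ρ | ∃ α β, IsState α ∧ IsState β ∧ ρ = prodStateAB α β}

/-- Classical relative entropy of two finitely supported output distributions. -/
def clRelEnt {m : ℕ} (P Q : Fin m → ℝ) : EReal :=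
  ∑ x, (if P x = 0 then (0 : EReal) else if Q x = 0 then (⊤ : EReal)
    else ((P x * Real.log (P x / Q x) : ℝ) : EReal))

/-- Measured relative entropy: supremum over all finite POVMs of the classical
relative entropy of the induced outcome distributions. -/
def measuredRelEnt {κ : Type*} [Fintype κ] [DecidableEq κ] (ρ σ : Matrix κ κ ℂ) : EReal :=
  ⨆ (m : ℕ) (E : Fin m → Matrix κ κ ℂ) (_ : ∀ x, (E x).PosSemidef) (_ : ∑ x, E x = 1),
    clRelEnt (fun x => (ρ * E x).trace.re) (fun x => (σ * E x).trace.re)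


/-- Axiom Q.I: there is a full-support free state `τ ∈ 𝒜₁` such that every `𝒜_{mk}`
is stable under blockwise depolarising towards `τ^{⊗k}`. -/
def AxiomQI {ι : Type*} [Fintype ι] [DecidableEq ι] (A : ∀ n : ℕ, Set (MatN ι n)) : Prop :=
  ∃ τ : MatC ι, tensorPow τ 1 ∈ A 1 ∧
    ∀ m k : ℕ, 1 ≤ m → 1 ≤ k → ∀ ρ ∈ A (m * k),
      suppLE ρ (tensorPow τ (m * k)) ∧
      ∀ δ ∈ Set.Icc (0 : ℝ) 1, blockDepolarize δ (tensorPow τ k) m ρ ∈ A (m * k)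

/-- Axiom Q.II: closedness under tensor powers. -/
def AxiomQII {ι : Type*} (A : ∀ n : ℕ, Set (MatN ι n)) : Prop :=
  ∀ m k : ℕ, 1 ≤ m → 1 ≤ k → ∀ ρ ∈ A k, powBlocks ρ m ∈ A (m * k)

/-- Axiom Q.III: closedness under permutations of the tensor factors. -/
def AxiomQIII {ι : Type*} (A : ∀ n : ℕ, Set (MatN ι n)) : Prop :=
  ∀ n : ℕ, ∀ ρ ∈ A n, ∀ π : Equiv.Perm (Fin n), permCopies π ρ ∈ A n

/-- Axiom Q.IV: filtering by Hermitian operators in a neighbourhood of the identity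
is completely `cone(𝒜)`-preserving. -/
def AxiomQIV {ι : Type*} [Fintype ι] [DecidableEq ι] (A : ∀ n : ℕ, Set (MatN ι n)) : Prop :=
  ∀ k : ℕ, 1 ≤ k →
    ∃ V : Set (MatN ι k), V ∈ nhds (1 : MatN ι k) ∧
      ∀ F ∈ V, F.IsHermitian → ∀ n : ℕ, 1 ≤ n → ∀ ρ ∈ A (n + k),
        ∃ (lam : ℝ) (ω : MatN ι n), 0 ≤ lam ∧ ω ∈ A n ∧ condReduce ρ F = (lam : ℂ) • ω


section Spectral

open Matrix

variable {κ : Type*} [Fintype κ]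

/-- The squared overlaps `|⟨uᵢ, vⱼ⟩|²` of the columns of two matrices. -/
def overlap (U V : Matrix κ κ ℂ) (i j : κ) : ℝ := Complex.normSq ((Uᴴ * V) i j)

lemma overlap_nonneg (U V : Matrix κ κ ℂ) (i j : κ) : 0 ≤ overlap U V i j :=
  Complex.normSq_nonneg _

lemma overlap_comm (U V : Matrix κ κ ℂ) (i j : κ) : overlap U V i j = overlap V U j i := by
  unfold overlap
  have : (Uᴴ * V) i j = star ((Vᴴ * U) j i) := by
    rw [← Matrix.conjTranspose_apply, Matrix.conjTranspose_mul, Matrix.conjTranspose_conjTranspose]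
  rw [this]
  exact Complex.normSq_conj _

variable [DecidableEq κ]

/-- The Hermitian matrix with eigenbasis the columns of `U` and eigenvalues `a`. -/
def conjDiag (U : Matrix κ κ ℂ) (a : κ → ℝ) : Matrix κ κ ℂ :=
  U * Matrix.diagonal (fun i => (a i : ℂ)) * Uᴴ

lemma conjDiag_apply_sum (U : Matrix κ κ ℂ) (a : κ → ℝ) (i j : κ) :
    conjDiag U a i j = ∑ k, (a k : ℂ) * (U i k * star (U j k)) := by
  simp only [conjDiag, Matrix.mul_apply, Matrix.diagonal_apply, Matrix.conjTranspose_apply]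
  refine Finset.sum_congr rfl fun k _ => ?_
  simp
  ring

lemma conjDiag_add (U : Matrix κ κ ℂ) (a b : κ → ℝ) :
    conjDiag U a + conjDiag U b = conjDiag U (fun i => a i + b i) := by
  ext i j
  simp only [Matrix.add_apply, conjDiag_apply_sum, ← Finset.sum_add_distrib]
  refine Finset.sum_congr rfl fun k _ => ?_
  push_cast
  ring

lemma conjDiag_sub (U : Matrix κ κ ℂ) (a b : κ → ℝ) :
    conjDiag U a - conjDiag U b = conjDiag U (fun i => a i - b i) := by
  ext i j
  simp only [Matrix.sub_apply, conjDiag_apply_sum, ← Finset.sum_sub_distrib]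
  refine Finset.sum_congr rfl fun k _ => ?_
  push_cast
  ring

lemma conjDiag_isHermitian (U : Matrix κ κ ℂ) (a : κ → ℝ) : (conjDiag U a).IsHermitian := by
  unfold conjDiag Matrix.IsHermitian
  simp only [Matrix.conjTranspose_mul, Matrix.conjTranspose_conjTranspose,
    Matrix.diagonal_conjTranspose, Matrix.mul_assoc]
  congr 2
  ext i j
  simp [Matrix.diagonal_apply]

lemma conjDiag_posSemidef (U : Matrix κ κ ℂ) {a : κ → ℝ} (ha : ∀ i, 0 ≤ a i) :
    (conjDiag U a).PosSemidef := by
  unfold conjDiag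
  refine Matrix.PosSemidef.mul_mul_conjTranspose_same ?_ U
  exact Matrix.posSemidef_diagonal_iff.2 fun i => by exact_mod_cast ha i

lemma conjDiag_one {U : Matrix κ κ ℂ} (hU : U * Uᴴ = 1) :
    conjDiag U (fun _ => 1) = 1 := by
  simp [conjDiag, hU]

lemma conjDiag_mul {U : Matrix κ κ ℂ} (hU : Uᴴ * U = 1) (a b : κ → ℝ) :
    conjDiag U a * conjDiag U b = conjDiag U (fun i => a i * b i) := by
  unfold conjDiag
  calc _ = U * Matrix.diagonal (fun i => (a i : ℂ)) * (Uᴴ * U) *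
        Matrix.diagonal (fun i => (b i : ℂ)) * Uᴴ := by simp only [Matrix.mul_assoc]
    _ = _ := by
      rw [hU, Matrix.mul_one, Matrix.mul_assoc U, Matrix.diagonal_mul_diagonal]
      simp

lemma trace_conjDiag_mul (U : Matrix κ κ ℂ) (a : κ → ℝ) (M : Matrix κ κ ℂ) :
    (conjDiag U a * M).trace = ∑ i, (a i : ℂ) * (Uᴴ * M * U) i i := by
  unfold conjDiag
  rw [Matrix.mul_assoc, Matrix.mul_assoc, Matrix.trace_mul_comm, Matrix.mul_assoc, Matrix.trace]
  simp [Matrix.diagonal_mul]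

lemma conjTranspose_conjDiag_diag (U V : Matrix κ κ ℂ) (b : κ → ℝ) (i : κ) :
    (Uᴴ * conjDiag V b * U) i i = ((∑ j, overlap U V i j * b j : ℝ) : ℂ) := by
  have h : Uᴴ * conjDiag V b * U = conjDiag (Uᴴ * V) b := by
    simp [conjDiag, Matrix.conjTranspose_mul, Matrix.mul_assoc]
  rw [h, conjDiag_apply_sum]
  push_cast
  refine Finset.sum_congr rfl fun k _ => ?_
  rw [mul_comm]
  congr 1
  exact Complex.mul_conj _

lemma trace_conjDiag_mul_conjDiag (U V : Matrix κ κ ℂ) (a b : κ → ℝ) :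
    (conjDiag U a * conjDiag V b).trace.re = ∑ i, ∑ j, a i * overlap U V i j * b j := by
  rw [trace_conjDiag_mul]
  simp only [conjTranspose_conjDiag_diag]
  rw [← Complex.ofReal_re (∑ i, ∑ j, a i * overlap U V i j * b j)]
  congr 1
  push_cast
  simp [Finset.mul_sum, mul_assoc]

lemma sum_overlap_right {U V : Matrix κ κ ℂ} (hU : Uᴴ * U = 1) (hV : V * Vᴴ = 1) (i : κ) :
    ∑ j, overlap U V i j = 1 := by
  have h := conjTranspose_conjDiag_diag U V (fun _ => 1) i
  rw [conjDiag_one hV, Matrix.mul_one, hU, Matrix.one_apply_eq] at h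
  simp only [mul_one] at h
  exact_mod_cast h.symm

lemma sum_overlap_left {U V : Matrix κ κ ℂ} (hU : U * Uᴴ = 1) (hV : Vᴴ * V = 1) (j : κ) :
    ∑ i, overlap U V i j = 1 := by
  simp_rw [overlap_comm U V]
  exact sum_overlap_right hV hU j

lemma sum_overlap_mul {U V : Matrix κ κ ℂ} (hU : Uᴴ * U = 1) (hV : V * Vᴴ = 1) (a : κ → ℝ) :
    ∑ i, ∑ j, a i * overlap U V i j = ∑ i, a i := by
  refine Finset.sum_congr rfl fun i _ => ?_
  rw [← Finset.mul_sum, sum_overlap_right hU hV, mul_one]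

lemma mul_sum_overlap {U V : Matrix κ κ ℂ} (hU : U * Uᴴ = 1) (hV : Vᴴ * V = 1) (b : κ → ℝ) :
    ∑ i, ∑ j, b j * overlap U V i j = ∑ j, b j := by
  rw [Finset.sum_comm]
  refine Finset.sum_congr rfl fun i _ => ?_
  rw [← Finset.mul_sum, sum_overlap_left hU hV, mul_one]

lemma eigenvectorUnitary_mul_conjTranspose {A : Matrix κ κ ℂ} (hA : A.IsHermitian) :
    (hA.eigenvectorUnitary : Matrix κ κ ℂ) * (hA.eigenvectorUnitary : Matrix κ κ ℂ)ᴴ = 1 :=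
  (Matrix.mem_unitaryGroup_iff).1 hA.eigenvectorUnitary.2

lemma eigenvectorUnitary_conjTranspose_mul {A : Matrix κ κ ℂ} (hA : A.IsHermitian) :
    (hA.eigenvectorUnitary : Matrix κ κ ℂ)ᴴ * (hA.eigenvectorUnitary : Matrix κ κ ℂ) = 1 :=
  (Matrix.mem_unitaryGroup_iff').1 hA.eigenvectorUnitary.2

lemma eq_conjDiag {A : Matrix κ κ ℂ} (hA : A.IsHermitian) :
    A = conjDiag (hA.eigenvectorUnitary : Matrix κ κ ℂ) hA.eigenvalues := by
  conv_lhs => rw [hA.spectral_theorem, Unitary.conjStarAlgAut_apply]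
  rfl

lemma matLog_eq_conjDiag {A : Matrix κ κ ℂ} (hA : A.IsHermitian) :
    matLog A = conjDiag (hA.eigenvectorUnitary : Matrix κ κ ℂ)
      (fun i => Real.log (hA.eigenvalues i)) := by
  rw [matLog, dif_pos hA]
  rfl

lemma sum_eigenvalues_of_isState {ρ : Matrix κ κ ℂ} (hρ : IsState ρ) :
    ∑ i, hρ.1.1.eigenvalues i = 1 := by
  have h := hρ.2.symm.trans hρ.1.1.trace_eq_sum_eigenvalues
  simpa using (congrArg Complex.re h).symm

lemma re_trace_mul_nonneg {A B : Matrix κ κ ℂ} (hA : A.PosSemidef) (hB : B.PosSemidef) :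
    0 ≤ (A * B).trace.re := by
  rw [eq_conjDiag hA.1, eq_conjDiag hB.1, trace_conjDiag_mul_conjDiag]
  exact Finset.sum_nonneg fun i _ => Finset.sum_nonneg fun j _ =>
    mul_nonneg (mul_nonneg (hA.eigenvalues_nonneg i) (overlap_nonneg _ _ _ _))
      (hB.eigenvalues_nonneg j)

/-- Expansion of `Tr[ρ (log ρ - log σ)]` along the eigenbases of `ρ` and `σ`. -/
lemma re_trace_matLog_sub {ρ σ : Matrix κ κ ℂ} (hρ : ρ.IsHermitian) (hσ : σ.IsHermitian) :
    (ρ * (matLog ρ - matLog σ)).trace.re =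
      ∑ i, hρ.eigenvalues i * Real.log (hρ.eigenvalues i) -
      ∑ i, ∑ j, hρ.eigenvalues i * overlap (hρ.eigenvectorUnitary : Matrix κ κ ℂ)
        (hσ.eigenvectorUnitary : Matrix κ κ ℂ) i j * Real.log (hσ.eigenvalues j) := by
  rw [Matrix.mul_sub, Matrix.trace_sub, Complex.sub_re, matLog_eq_conjDiag hρ,
    matLog_eq_conjDiag hσ]
  have h1 : ρ * conjDiag (hρ.eigenvectorUnitary : Matrix κ κ ℂ)
      (fun i => Real.log (hρ.eigenvalues i)) = conjDiag (hρ.eigenvectorUnitary : Matrix κ κ ℂ)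
      (fun i => hρ.eigenvalues i * Real.log (hρ.eigenvalues i)) := by
    conv_lhs => enter [1]; rw [eq_conjDiag hρ]
    exact conjDiag_mul (eigenvectorUnitary_conjTranspose_mul hρ) _ _
  have h2 : (ρ * conjDiag (hσ.eigenvectorUnitary : Matrix κ κ ℂ)
      (fun i => Real.log (hσ.eigenvalues i))).trace.re =
      ∑ i, ∑ j, hρ.eigenvalues i * overlap (hρ.eigenvectorUnitary : Matrix κ κ ℂ)
        (hσ.eigenvectorUnitary : Matrix κ κ ℂ) i j * Real.log (hσ.eigenvalues j) := by
    conv_lhs => enter [1, 1, 1]; rw [eq_conjDiag hρ]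
    exact trace_conjDiag_mul_conjDiag _ _ _ _
  rw [h1, h2]
  congr 1
  rw [← Matrix.mul_one (conjDiag _ _), trace_conjDiag_mul]
  simp [eigenvectorUnitary_conjTranspose_mul hρ]

end Spectral

section WeakConverse

open Matrix

variable {κ : Type*} [Fintype κ] [DecidableEq κ]

lemma overlap_eq_zero_of_suppLE {ρ σ : Matrix κ κ ℂ} (hρ : ρ.IsHermitian) (hσ : σ.IsHermitian)
    (h : suppLE ρ σ) {j : κ} (hj : hσ.eigenvalues j = 0) (i : κ) :
    hρ.eigenvalues i * overlap (hρ.eigenvectorUnitary : Matrix κ κ ℂ)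
      (hσ.eigenvectorUnitary : Matrix κ κ ℂ) i j = 0 := by
  set U : Matrix κ κ ℂ := (hρ.eigenvectorUnitary : Matrix κ κ ℂ) with hU
  set V : Matrix κ κ ℂ := (hσ.eigenvectorUnitary : Matrix κ κ ℂ) with hV
  have hUU : Uᴴ * U = 1 := eigenvectorUnitary_conjTranspose_mul hρ
  have hVV : Vᴴ * V = 1 := eigenvectorUnitary_conjTranspose_mul hσ
  have hσV : ∀ x : κ → ℂ, (Vᴴ *ᵥ (σ *ᵥ x)) j = 0 := by
    intro x
    have : Vᴴ * σ = Matrix.diagonal (fun i => ((hσ.eigenvalues i : ℝ) : ℂ)) * Vᴴ := by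
      conv_lhs => rw [eq_conjDiag hσ]
      rw [conjDiag, ← hV, ← Matrix.mul_assoc, ← Matrix.mul_assoc, hVV, Matrix.one_mul]
    rw [Matrix.mulVec_mulVec, this, ← Matrix.mulVec_mulVec, Matrix.mulVec_diagonal, hj]
    simp
  have hρV : ∀ x : κ → ℂ, (Vᴴ *ᵥ (ρ *ᵥ x)) j = 0 := by
    intro x
    obtain ⟨y, hy⟩ := h ⟨x, rfl⟩
    rw [Matrix.toLin'_apply, Matrix.toLin'_apply] at hy
    rw [← hy]
    exact hσV y
  have hz : (Vᴴ * ρ * U) j i = 0 := by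
    have := hρV (U *ᵥ Pi.single i 1)
    rw [Matrix.mulVec_mulVec, Matrix.mulVec_mulVec] at this
    simpa [Matrix.mul_assoc] using this
  have hρU : ρ * U = U * Matrix.diagonal (fun i => ((hρ.eigenvalues i : ℝ) : ℂ)) := by
    conv_lhs => enter [1]; rw [eq_conjDiag hρ]
    rw [conjDiag, ← hU, Matrix.mul_assoc, hUU, Matrix.mul_one]
  rw [Matrix.mul_assoc, hρU, ← Matrix.mul_assoc, Matrix.mul_diagonal, mul_eq_zero] at hz
  rw [overlap_comm]
  rcases hz with hz | hz
  · simp [overlap, hz]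
  · rw [Complex.ofReal_eq_zero.1 hz, zero_mul]

/-- A likelihood-ratio lower bound on the relative entropy, in terms of the joint distribution
`pᵢ |⟨uᵢ, vⱼ⟩|²` built from the spectral decompositions. -/
lemma log_mul_sum_sub_one_le {ρ σ : Matrix κ κ ℂ} (hρ : IsState ρ) (hσ : IsState σ)
    (h : suppLE ρ σ) {t : ℝ} (ht : 0 < t) :
    Real.log t * (∑ i, ∑ j, if t * hσ.1.1.eigenvalues j < hρ.1.1.eigenvalues i then
      hρ.1.1.eigenvalues i * overlap (hρ.1.1.eigenvectorUnitary : Matrix κ κ ℂ)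
        (hσ.1.1.eigenvectorUnitary : Matrix κ κ ℂ) i j else 0) - 1 ≤
      (ρ * (matLog ρ - matLog σ)).trace.re := by
  have hz := fun j hj i => overlap_eq_zero_of_suppLE hρ.1.1 hσ.1.1 h (j := j) hj i
  rw [re_trace_matLog_sub hρ.1.1 hσ.1.1]
  have hp := hρ.1.eigenvalues_nonneg
  have hq := hσ.1.eigenvalues_nonneg
  have hsq := sum_eigenvalues_of_isState hσ
  set p := hρ.1.1.eigenvalues
  set q := hσ.1.1.eigenvalues
  set U : Matrix κ κ ℂ := (hρ.1.1.eigenvectorUnitary : Matrix κ κ ℂ)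
  set V : Matrix κ κ ℂ := (hσ.1.1.eigenvectorUnitary : Matrix κ κ ℂ)
  have hUU : Uᴴ * U = 1 := eigenvectorUnitary_conjTranspose_mul hρ.1.1
  have hUU' : U * Uᴴ = 1 := eigenvectorUnitary_mul_conjTranspose hρ.1.1
  have hVV : Vᴴ * V = 1 := eigenvectorUnitary_conjTranspose_mul hσ.1.1
  have hVV' : V * Vᴴ = 1 := eigenvectorUnitary_mul_conjTranspose hσ.1.1
  have e1 : ∑ i, p i * Real.log (p i) = ∑ i, ∑ j, (p i * Real.log (p i)) * overlap U V i j :=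
    (sum_overlap_mul hUU hVV' _).symm
  have e2 : (1 : ℝ) = ∑ i, ∑ j, q j * overlap U V i j := by
    rw [mul_sum_overlap hUU' hVV, hsq]
  rw [e1, e2, Finset.mul_sum, ← Finset.sum_sub_distrib, ← Finset.sum_sub_distrib]
  refine Finset.sum_le_sum fun i _ => ?_
  rw [Finset.mul_sum, ← Finset.sum_sub_distrib, ← Finset.sum_sub_distrib]
  refine Finset.sum_le_sum fun j _ => ?_
  have hW := overlap_nonneg U V i j
  have hpi := hp i
  have hqj := hq j
  rcases hqj.eq_or_lt with h0 | h0
  · have := hz j h0.symm i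
    rw [← h0]
    have e : p i * Real.log (p i) * overlap U V i j = 0 := by
      rw [mul_right_comm, this, zero_mul]
    rw [e, this]
    split_ifs <;> simp
  split_ifs with hc
  · have hp0 : 0 < p i := lt_trans (mul_pos ht h0) hc
    have hl : Real.log t + Real.log (q j) ≤ Real.log (p i) := by
      rw [← Real.log_mul ht.ne' h0.ne']
      exact Real.log_le_log (mul_pos ht h0) hc.le
    have := mul_le_mul_of_nonneg_left hl (mul_nonneg hpi hW)
    nlinarith [mul_nonneg hqj hW]
  · rcases hpi.eq_or_lt with hp0 | hp0
    · rw [← hp0]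
      simp only [mul_zero, zero_mul, sub_zero, zero_sub]
      nlinarith [mul_nonneg hqj hW]
    · have hl : Real.log (q j) - Real.log (p i) ≤ q j / p i - 1 := by
        rw [← Real.log_div h0.ne' hp0.ne']
        exact Real.log_le_sub_one_of_pos (div_pos h0 hp0)
      have h3 := mul_le_mul_of_nonneg_left hl (mul_nonneg hpi hW)
      have h4 : p i * overlap U V i j * (q j / p i - 1) =
          q j * overlap U V i j - p i * overlap U V i j := by
        field_simp
      nlinarith [mul_nonneg hpi hW]

lemma neg_one_le_relEnt {ρ σ : Matrix κ κ ℂ} (hρ : IsState ρ) (hσ : IsState σ) :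
    ((-1 : ℝ) : EReal) ≤ relEnt ρ σ := by
  unfold relEnt
  split_ifs with h
  · have := log_mul_sum_sub_one_le hρ hσ h one_pos
    rw [Real.log_one, zero_mul, zero_sub] at this
    exact_mod_cast this
  · exact le_top

lemma posSemidef_sub_mul_self {E : Matrix κ κ ℂ} (hE : E.PosSemidef)
    (hE' : (1 - E).PosSemidef) : (E - E * E).PosSemidef := by
  have h1 := hE'.conjTranspose_mul_mul_same E
  have h2 := hE.conjTranspose_mul_mul_same (1 - E)
  rw [hE.1.eq] at h1
  rw [hE'.1.eq] at h2
  have := h1.add h2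
  convert this using 1
  noncomm_ring

lemma sum_normSq_le_re_trace {ρ E V : Matrix κ κ ℂ} (hρ : ρ.PosSemidef) (hE : E.PosSemidef)
    (hE' : (1 - E).PosSemidef) (hV : V * Vᴴ = 1) :
    ∑ i, ∑ j, hρ.1.eigenvalues i * Complex.normSq
      (((hρ.1.eigenvectorUnitary : Matrix κ κ ℂ)ᴴ * E * V) i j) ≤ (ρ * E).trace.re := by
  have h1 := re_trace_mul_nonneg hρ (posSemidef_sub_mul_self hE hE')
  rw [Matrix.mul_sub, Matrix.trace_sub, Complex.sub_re, sub_nonneg] at h1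
  refine le_trans (le_of_eq ?_) h1
  conv_rhs => enter [1, 1, 1]; rw [eq_conjDiag hρ.1]
  rw [trace_conjDiag_mul, Complex.re_sum]
  refine Finset.sum_congr rfl fun i _ => ?_
  set U : Matrix κ κ ℂ := (hρ.1.eigenvectorUnitary : Matrix κ κ ℂ)
  have h2 : Uᴴ * (E * E) * U = (Uᴴ * E * V) * (Uᴴ * E * V)ᴴ := by
    simp only [Matrix.conjTranspose_mul, Matrix.conjTranspose_conjTranspose, hE.1.eq]
    calc _ = Uᴴ * E * 1 * E * U := by simp only [Matrix.mul_one, Matrix.mul_assoc]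
      _ = _ := by rw [← hV]; simp only [Matrix.mul_assoc]
  rw [h2, Matrix.mul_apply, ← Finset.mul_sum, Complex.re_ofReal_mul, Complex.re_sum]
  congr 1
  refine Finset.sum_congr rfl fun j _ => ?_
  rw [Matrix.conjTranspose_apply]
  change _ = ((Uᴴ * E * V) i j * (starRingEnd ℂ) ((Uᴴ * E * V) i j)).re
  rw [Complex.mul_conj, Complex.ofReal_re]

/-- One-shot weak converse: a test with type I error at most `ε` and type II error at most `b`
forces the relative entropy to be at least about `log (ε / b)`. -/
lemma le_relEnt_of_test {ρ σ E : Matrix κ κ ℂ} (hρ : IsState ρ) (hσ : IsState σ)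
    (hE : E.PosSemidef) (hE' : (1 - E).PosSemidef) {ε b : ℝ} (hb : 0 < b) (hbε : b ≤ ε)
    (h1 : (ρ * (1 - E)).trace.re ≤ ε) (h2 : (σ * E).trace.re ≤ b) :
    (((1 - 4 * ε) * (Real.log ε - Real.log b) - 1 : ℝ) : EReal) ≤ relEnt ρ σ := by
  unfold relEnt
  split_ifs with h
  swap
  · exact le_top
  have hε : 0 < ε := hb.trans_le hbε
  have ht : 0 < ε / b := div_pos hε hb
  have key := log_mul_sum_sub_one_le hρ hσ h ht
  have hp := hρ.1.eigenvalues_nonneg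
  have hq := hσ.1.eigenvalues_nonneg
  have hsp := sum_eigenvalues_of_isState hρ
  have hUU : (hρ.1.1.eigenvectorUnitary : Matrix κ κ ℂ)ᴴ * hρ.1.1.eigenvectorUnitary = 1 :=
    eigenvectorUnitary_conjTranspose_mul hρ.1.1
  have hUU' : (hρ.1.1.eigenvectorUnitary : Matrix κ κ ℂ) *
    (hρ.1.1.eigenvectorUnitary : Matrix κ κ ℂ)ᴴ = 1 := eigenvectorUnitary_mul_conjTranspose hρ.1.1
  have hVV' : (hσ.1.1.eigenvectorUnitary : Matrix κ κ ℂ) *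
    (hσ.1.1.eigenvectorUnitary : Matrix κ κ ℂ)ᴴ = 1 := eigenvectorUnitary_mul_conjTranspose hσ.1.1
  have h3 := (sum_normSq_le_re_trace hρ.1 hE' (by simpa using hE) hVV').trans h1
  have h4 := (sum_normSq_le_re_trace hσ.1 hE hE' hUU').trans h2
  rw [Finset.sum_comm] at h4
  set p := hρ.1.1.eigenvalues
  set q := hσ.1.1.eigenvalues
  set U : Matrix κ κ ℂ := (hρ.1.1.eigenvectorUnitary : Matrix κ κ ℂ)
  set V : Matrix κ κ ℂ := (hσ.1.1.eigenvectorUnitary : Matrix κ κ ℂ)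
  have hsum : (1 : ℝ) - 4 * ε ≤ ∑ i, ∑ j, if ε / b * q j < p i then
      p i * overlap U V i j else 0 := by
    have e1 : (1 : ℝ) = ∑ i, ∑ j, p i * overlap U V i j := by
      rw [sum_overlap_mul hUU hVV', hsp]
    have e2 : ∑ i, ∑ j, p i * overlap U V i j ≤
        ∑ i, ∑ j, ((if ε / b * q j < p i then p i * overlap U V i j else 0) +
          (2 * (p i * Complex.normSq ((Uᴴ * (1 - E) * V) i j)) +
          2 * (ε / b * (q j * Complex.normSq ((Vᴴ * E * U) j i))))) := by
      refine Finset.sum_le_sum fun i _ => Finset.sum_le_sum fun j _ => ?_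
      have a1 := mul_nonneg (hp i) (Complex.normSq_nonneg ((Uᴴ * (1 - E) * V) i j))
      have a2 := mul_nonneg ht.le (mul_nonneg (hq j)
        (Complex.normSq_nonneg ((Vᴴ * E * U) j i)))
      split_ifs with hc
      · linarith
      · have b1 : (Uᴴ * V) i j = (Uᴴ * (1 - E) * V) i j + (Uᴴ * E * V) i j := by
          rw [← Matrix.add_apply, ← Matrix.add_mul, ← Matrix.mul_add, sub_add_cancel,
            Matrix.mul_one]
        have b2 : Complex.normSq ((Vᴴ * E * U) j i) = Complex.normSq ((Uᴴ * E * V) i j) := by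
          have : (Vᴴ * E * U) j i = star ((Uᴴ * E * V) i j) := by
            rw [← Matrix.conjTranspose_apply]
            simp only [Matrix.conjTranspose_mul, Matrix.conjTranspose_conjTranspose, hE.1.eq,
              Matrix.mul_assoc]
          rw [this]
          exact Complex.normSq_conj _
        have b3 : overlap U V i j ≤ 2 * Complex.normSq ((Uᴴ * (1 - E) * V) i j) +
            2 * Complex.normSq ((Uᴴ * E * V) i j) := by
          rw [overlap, b1]
          simp only [Complex.normSq_apply, Complex.add_re, Complex.add_im]
          nlinarith [sq_nonneg (((Uᴴ * (1 - E) * V) i j).re - ((Uᴴ * E * V) i j).re),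
            sq_nonneg (((Uᴴ * (1 - E) * V) i j).im - ((Uᴴ * E * V) i j).im)]
        rw [b2]
        push Not at hc
        have b4 := mul_le_mul_of_nonneg_left b3 (hp i)
        have b5 := mul_le_mul_of_nonneg_right hc (Complex.normSq_nonneg ((Uᴴ * E * V) i j))
        nlinarith
    rw [← e1] at e2
    have e3 := mul_le_mul_of_nonneg_left h4 ht.le
    simp only [Finset.sum_add_distrib, ← Finset.mul_sum] at e2 e3 h3
    rw [div_mul_cancel₀ _ hb.ne'] at e3
    linarith
  have hl : 0 ≤ Real.log (ε / b) := Real.log_nonneg (by rwa [le_div_iff₀ hb, one_mul])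
  have := mul_le_mul_of_nonneg_left hsum hl
  rw [Real.log_div hε.ne' hb.ne'] at this key
  exact_mod_cast (by linarith : (1 - 4 * ε) * (Real.log ε - Real.log b) - 1 ≤ _)

end WeakConverse

section Variational

open Matrix

variable {κ : Type*} [Fintype κ] [DecidableEq κ]

/-- Every diagonal of the Hermitian matrix `K` in an orthonormal basis has exponential sum at
most `c`; by Peierls' inequality this says `Tr exp K ≤ c`. -/
def TraceExpLE (K : Matrix κ κ ℂ) (c : ℝ) : Prop :=
  ∀ U : Matrix κ κ ℂ, Uᴴ * U = 1 → U * Uᴴ = 1 → ∑ i, Real.exp ((Uᴴ * K * U) i i).re ≤ c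

lemma traceExpLE_conjDiag {V : Matrix κ κ ℂ} (hV : Vᴴ * V = 1) (hV' : V * Vᴴ = 1)
    {k : κ → ℝ} {c : ℝ} (hk : ∑ i, Real.exp (k i) ≤ c) : TraceExpLE (conjDiag V k) c := by
  intro U hU hU'
  refine le_trans ?_ hk
  rw [← mul_sum_overlap hU' hV (fun i => Real.exp (k i))]
  refine Finset.sum_le_sum fun i _ => ?_
  rw [conjTranspose_conjDiag_diag, Complex.ofReal_re]
  have := convexOn_exp.map_sum_le (t := Finset.univ) (w := fun j => overlap U V i j) (p := k)
    (fun j _ => overlap_nonneg U V i j) (sum_overlap_right hU hV' i) (fun _ _ => Set.mem_univ _)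
  simpa [mul_comm] using this

lemma TraceExpLE.mono {K K' : Matrix κ κ ℂ} {c : ℝ} (h : TraceExpLE K' c)
    (hK : (K' - K).PosSemidef) : TraceExpLE K c := by
  intro U hU hU'
  refine le_trans (Finset.sum_le_sum fun i _ => Real.exp_le_exp.2 ?_) (h U hU hU')
  have := (hK.conjTranspose_mul_mul_same U).diag_nonneg (i := i)
  rw [Matrix.mul_sub, Matrix.sub_mul, Matrix.sub_apply] at this
  have := (Complex.le_def.1 this).1
  rw [Complex.sub_re, Complex.zero_re] at this
  linarith

lemma TraceExpLE.combine {K K' : Matrix κ κ ℂ} {c : ℝ} (h : TraceExpLE K c)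
    (h' : TraceExpLE K' c) {a b : ℝ} (ha : 0 ≤ a) (hb : 0 ≤ b) (hab : a + b = 1) :
    TraceExpLE (a • K + b • K') c := by
  intro U hU hU'
  have e : ∀ i, ((Uᴴ * (a • K + b • K') * U) i i).re =
      a * ((Uᴴ * K * U) i i).re + b * ((Uᴴ * K' * U) i i).re := by
    intro i
    simp [Matrix.mul_add, Matrix.add_mul]
  simp only [e]
  calc _ ≤ ∑ i, (a * Real.exp ((Uᴴ * K * U) i i).re + b * Real.exp ((Uᴴ * K' * U) i i).re) := by
        refine Finset.sum_le_sum fun i _ => ?_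
        simpa using convexOn_exp.2 (Set.mem_univ ((Uᴴ * K * U) i i).re)
          (Set.mem_univ ((Uᴴ * K' * U) i i).re) ha hb hab
    _ = a * ∑ i, Real.exp ((Uᴴ * K * U) i i).re + b * ∑ i, Real.exp ((Uᴴ * K' * U) i i).re := by
        rw [Finset.sum_add_distrib, Finset.mul_sum, Finset.mul_sum]
    _ ≤ a * c + b * c := add_le_add (mul_le_mul_of_nonneg_left (h U hU hU') ha)
        (mul_le_mul_of_nonneg_left (h' U hU hU') hb)
    _ = c := by rw [← add_mul, hab, one_mul]

lemma exp_conjDiag {U : Matrix κ κ ℂ} (hU : Uᴴ * U = 1) (hU' : U * Uᴴ = 1) (k : κ → ℝ) :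
    NormedSpace.exp (conjDiag U k) = conjDiag U (fun i => Real.exp (k i)) := by
  have := Matrix.exp_units_conj (⟨U, Uᴴ, hU', hU⟩ : (Matrix κ κ ℂ)ˣ)
    (Matrix.diagonal fun i => (k i : ℂ))
  simp only [Units.inv_mk] at this
  rw [conjDiag, this, Matrix.exp_diagonal, conjDiag]
  congr 3
  ext i
  rw [Pi.coe_exp, ← Complex.exp_eq_exp_ℂ, Complex.ofReal_exp]

lemma trace_conjDiag {U : Matrix κ κ ℂ} (hU : Uᴴ * U = 1) (k : κ → ℝ) :
    (conjDiag U k).trace = ((∑ i, k i : ℝ) : ℂ) := by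
  have := trace_conjDiag_mul U k 1
  rw [Matrix.mul_one, Matrix.mul_one, hU] at this
  simpa using this

lemma TraceExpLE.sum_le_of_commute {Y V : Matrix κ κ ℂ} (hY : Yᴴ * Y = 1) (hY' : Y * Yᴴ = 1)
    (hV : Vᴴ * V = 1) (hV' : V * Vᴴ = 1) {h l : κ → ℝ} {c : ℝ}
    (hc : Commute (conjDiag Y h) (conjDiag V l)) (hK : TraceExpLE (conjDiag Y h + conjDiag V l) c) :
    ∑ i, ∑ j, Real.exp (h i) * overlap Y V i j * Real.exp (l j) ≤ c := by
  have hH : (conjDiag Y h + conjDiag V l).IsHermitian :=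
    (conjDiag_isHermitian Y h).add (conjDiag_isHermitian V l)
  have e := Matrix.exp_add_of_commute _ _ hc
  rw [exp_conjDiag hY hY', exp_conjDiag hV hV'] at e
  rw [← trace_conjDiag_mul_conjDiag, ← e]
  obtain ⟨W, w, hW, hW', hw⟩ : ∃ (W : Matrix κ κ ℂ) (w : κ → ℝ), Wᴴ * W = 1 ∧ W * Wᴴ = 1 ∧
      conjDiag Y h + conjDiag V l = conjDiag W w :=
    ⟨_, _, eigenvectorUnitary_conjTranspose_mul hH, eigenvectorUnitary_mul_conjTranspose hH,
      eq_conjDiag hH⟩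
  rw [hw] at hK ⊢
  rw [exp_conjDiag hW hW', trace_conjDiag hW, Complex.ofReal_re]
  refine le_trans (le_of_eq (Finset.sum_congr rfl fun i _ => ?_)) (hK _ hW hW')
  have : Wᴴ * conjDiag W w * W = Matrix.diagonal fun i => (w i : ℂ) := by
    rw [conjDiag, Matrix.mul_assoc, Matrix.mul_assoc, hW, Matrix.mul_one, ← Matrix.mul_assoc, hW,
      Matrix.one_mul]
  rw [this, Matrix.diagonal_apply_eq, Complex.ofReal_re]

lemma commute_conjDiag_comp {T M : Matrix κ κ ℂ} (hT : Tᴴ * T = 1) (hT' : T * Tᴴ = 1)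
    {t : κ → ℝ} (h : Commute (conjDiag T t) M) (f : ℝ → ℝ) :
    Commute (conjDiag T (fun i => f (t i))) M := by
  have conj : ∀ a : κ → ℝ, Commute (conjDiag T a) M ↔
      ∀ i j, (a i : ℂ) * (Tᴴ * M * T) i j = (Tᴴ * M * T) i j * (a j : ℂ) := by
    intro a
    have e1 : Tᴴ * (conjDiag T a * M) * T = Matrix.diagonal (fun i => (a i : ℂ)) * (Tᴴ * M * T) := by
      calc _ = (Tᴴ * T) * Matrix.diagonal (fun i => (a i : ℂ)) * (Tᴴ * M * T) := by
            simp only [conjDiag, Matrix.mul_assoc]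
        _ = _ := by rw [hT, Matrix.one_mul]
    have e2 : Tᴴ * (M * conjDiag T a) * T = (Tᴴ * M * T) * Matrix.diagonal (fun i => (a i : ℂ)) := by
      calc _ = (Tᴴ * M * T) * Matrix.diagonal (fun i => (a i : ℂ)) * (Tᴴ * T) := by
            simp only [conjDiag, Matrix.mul_assoc]
        _ = _ := by rw [hT, Matrix.mul_one]
    have e3 : ∀ X : Matrix κ κ ℂ, T * (Tᴴ * X * T) * Tᴴ = X := by
      intro X
      calc _ = (T * Tᴴ) * X * (T * Tᴴ) := by simp only [Matrix.mul_assoc]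
        _ = X := by rw [hT', Matrix.one_mul, Matrix.mul_one]
    constructor
    · intro hc i j
      have := congrFun (congrFun (e1.symm.trans ((congrArg (fun X => Tᴴ * X * T) hc.eq).trans e2)) i) j
      rwa [Matrix.diagonal_mul, Matrix.mul_diagonal] at this
    · intro hc
      have : Tᴴ * (conjDiag T a * M) * T = Tᴴ * (M * conjDiag T a) * T := by
        rw [e1, e2]
        ext i j
        rw [Matrix.diagonal_mul, Matrix.mul_diagonal]
        exact hc i j
      have h2 := congrArg (fun X => T * X * Tᴴ) this
      simp only [e3] at h2
      exact h2
  rw [conj] at h ⊢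
  intro i j
  have := h i j
  by_cases hij : t i = t j
  · rw [hij, mul_comm]
  · have h0 : (Tᴴ * M * T) i j = 0 := by
      have h1 : ((t i : ℂ) - t j) * (Tᴴ * M * T) i j = 0 := by rw [sub_mul, this]; ring
      rcases mul_eq_zero.1 h1 with h2 | h2
      · exact absurd (by exact_mod_cast sub_eq_zero.1 h2) hij
      · exact h2
    rw [h0]
    simp

end Variational

section Pinching

open Matrix

variable {κ : Type*} [Fintype κ] [DecidableEq κ]

lemma conjDiag_smul (U : Matrix κ κ ℂ) (c : ℝ) (a : κ → ℝ) :
    c • conjDiag U a = conjDiag U (fun i => c * a i) := by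
  ext i j
  simp only [Matrix.smul_apply, conjDiag_apply_sum, Finset.smul_sum, Complex.real_smul]
  refine Finset.sum_congr rfl fun k _ => ?_
  push_cast
  ring

lemma conjDiag_sum {α : Type*} (s : Finset α) (U : Matrix κ κ ℂ) (a : α → κ → ℝ) :
    ∑ x ∈ s, conjDiag U (a x) = conjDiag U (fun i => ∑ x ∈ s, a x i) := by
  ext i j
  simp only [Matrix.sum_apply, conjDiag_apply_sum]
  rw [Finset.sum_comm]
  refine Finset.sum_congr rfl fun k _ => ?_
  push_cast
  rw [Finset.sum_mul]

/-- The pinching inequality, for the pinching with respect to the eigenspaces of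
`conjDiag V q`. -/
lemma exists_pinching {V : Matrix κ κ ℂ} (hV : Vᴴ * V = 1) (hV' : V * Vᴴ = 1) (q : κ → ℝ)
    {ρ : Matrix κ κ ℂ} (hρ : IsState ρ) :
    ∃ τ : Matrix κ κ ℂ, IsState τ ∧ Commute (conjDiag V q) τ ∧
      (((Finset.univ.image q).card : ℝ) • τ - ρ).PosSemidef := by
  set S := Finset.univ.image q
  let P : ℝ → Matrix κ κ ℂ := fun x => conjDiag V (fun j => if q j = x then 1 else 0)
  have hP : ∀ x, (P x)ᴴ = P x := fun x => conjDiag_isHermitian _ _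
  have hPP : ∀ x, P x * P x = P x := fun x => by
    simp only [P]
    rw [conjDiag_mul hV]
    congr 1
    ext j
    split_ifs <;> simp
  have hsum : ∑ x ∈ S, P x = 1 := by
    rw [conjDiag_sum, ← conjDiag_one hV']
    congr 1
    ext j
    rw [Finset.sum_ite_eq, if_pos (Finset.mem_image_of_mem q (Finset.mem_univ j))]
  have hωP : ∀ x, conjDiag V q * P x = x • P x := fun x => by
    simp only [P]
    rw [conjDiag_mul hV, conjDiag_smul]
    congr 1
    ext j
    split_ifs with h <;> simp [h]
  have hPω : ∀ x, P x * conjDiag V q = x • P x := fun x => by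
    simp only [P]
    rw [conjDiag_mul hV, conjDiag_smul]
    congr 1
    ext j
    split_ifs with h <;> simp [h]
  have hpsd : ∀ A : Matrix κ κ ℂ, Aᴴ = A → (A * ρ * A).PosSemidef := fun A hA => by
    have := hρ.1.conjTranspose_mul_mul_same A
    rwa [hA] at this
  refine ⟨∑ x ∈ S, P x * ρ * P x, ⟨?_, ?_⟩, ?_, ?_⟩
  · exact Matrix.posSemidef_sum _ fun x _ => hpsd _ (hP x)
  · rw [Matrix.trace_sum]
    have : ∀ x ∈ S, (P x * ρ * P x).trace = (P x * ρ).trace := fun x _ => by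
      rw [Matrix.trace_mul_comm, ← Matrix.mul_assoc, hPP]
    rw [Finset.sum_congr rfl this, ← Matrix.trace_sum, ← Finset.sum_mul, hsum, Matrix.one_mul,
      hρ.2]
  · change _ * _ = _ * _
    rw [Finset.mul_sum, Finset.sum_mul]
    refine Finset.sum_congr rfl fun x _ => ?_
    rw [← Matrix.mul_assoc, ← Matrix.mul_assoc, hωP, Matrix.mul_assoc _ _ (conjDiag V q), hPω]
    simp
  · have key : (∑ x ∈ S, ∑ y ∈ S, (P x - P y) * ρ * (P x - P y)) =
        (2 : ℝ) • ((S.card : ℝ) • (∑ x ∈ S, P x * ρ * P x) - ρ) := by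
      have e : ∀ x y, (P x - P y) * ρ * (P x - P y) =
          (P x * ρ * P x + P y * ρ * P y) - (P x * ρ * P y + P y * ρ * P x) := fun x y => by
        noncomm_ring
      have e1 : ∑ x ∈ S, ∑ y ∈ S, P x * ρ * P y = ρ := by
        simp only [← Finset.mul_sum, ← Finset.sum_mul, hsum]
        simp
      have e2 : ∑ x ∈ S, ∑ y ∈ S, P y * ρ * P x = ρ := by
        rw [Finset.sum_comm]; exact e1
      simp only [e, Finset.sum_sub_distrib, Finset.sum_add_distrib, e1, e2, Finset.sum_const]
      rw [← Finset.smul_sum, smul_sub, two_smul, two_smul, Nat.cast_smul_eq_nsmul]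
    have h2 : ((S.card : ℝ) • (∑ x ∈ S, P x * ρ * P x) - ρ) =
        (2⁻¹ : ℝ) • ∑ x ∈ S, ∑ y ∈ S, (P x - P y) * ρ * (P x - P y) := by
      rw [key, smul_smul, inv_mul_cancel₀ two_ne_zero, one_smul]
    rw [h2]
    refine Matrix.PosSemidef.smul ?_ (by positivity)
    refine Matrix.posSemidef_sum _ fun x _ => Matrix.posSemidef_sum _ fun y _ => hpsd _ ?_
    rw [Matrix.conjTranspose_sub, hP, hP]

lemma exists_posDef_pinching {V : Matrix κ κ ℂ} (hV : Vᴴ * V = 1) (hV' : V * Vᴴ = 1)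
    (q : κ → ℝ) {ρ : Matrix κ κ ℂ} (hρ : IsState ρ) :
    ∃ (T : Matrix κ κ ℂ) (t : κ → ℝ), Tᴴ * T = 1 ∧ T * Tᴴ = 1 ∧ (∀ i, 0 < t i) ∧ ∑ i, t i = 1 ∧
      Commute (conjDiag V q) (conjDiag T t) ∧
      ((2 * (Finset.univ.image q).card : ℝ) • conjDiag T t - ρ).PosSemidef := by
  obtain ⟨τ, hτ, hc, hle⟩ := exists_pinching hV hV' q hρ
  have hs0 := hτ.1.eigenvalues_nonneg
  have hs1 := sum_eigenvalues_of_isState hτ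
  have hT := eigenvectorUnitary_conjTranspose_mul hτ.1.1
  have hT' := eigenvectorUnitary_mul_conjTranspose hτ.1.1
  have hτe := eq_conjDiag hτ.1.1
  set s := hτ.1.1.eigenvalues
  set T : Matrix κ κ ℂ := (hτ.1.1.eigenvectorUnitary : Matrix κ κ ℂ)
  have hne : Nonempty κ := by
    by_contra h
    rw [not_nonempty_iff] at h
    simp at hs1
  have hD : (0 : ℝ) < (Fintype.card κ : ℝ) := by exact_mod_cast Fintype.card_pos
  have ht : conjDiag T (fun i => 2⁻¹ * (s i + (Fintype.card κ : ℝ)⁻¹)) =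
      (2⁻¹ : ℝ) • (τ + (Fintype.card κ : ℝ)⁻¹ • (1 : Matrix κ κ ℂ)) := by
    rw [← conjDiag_smul, ← conjDiag_add, ← hτe, ← conjDiag_one hT', conjDiag_smul]
    simp
  refine ⟨T, fun i => 2⁻¹ * (s i + (Fintype.card κ : ℝ)⁻¹), hT, hT', fun i => ?_, ?_, ?_, ?_⟩
  · have := hs0 i
    positivity
  · rw [← Finset.mul_sum, Finset.sum_add_distrib, hs1]
    simp only [Finset.sum_const, Finset.card_univ, nsmul_eq_mul]
    rw [mul_inv_cancel₀ hD.ne']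
    norm_num
  · rw [ht]
    exact (hc.add_right ((Commute.one_right _).smul_right _)).smul_right _
  · rw [ht, smul_smul]
    have : (2 * (Finset.univ.image q).card : ℝ) * 2⁻¹ = (Finset.univ.image q).card := by ring
    rw [this, smul_add, add_sub_right_comm]
    have h1 : (0 : ℝ) ≤ (Fintype.card κ : ℝ)⁻¹ := inv_nonneg.2 hD.le
    have h2 : (0 : ℝ) ≤ ((Finset.univ.image q).card : ℝ) := Nat.cast_nonneg _
    exact hle.add ((Matrix.PosSemidef.one.smul h1).smul h2)

/-- If `ρ ≤ c τ` then `Tr ρ (log ρ - log τ) ≤ log c`. -/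
lemma sum_mul_log_sub_le {U T : Matrix κ κ ℂ} (hU : Uᴴ * U = 1) (hT : Tᴴ * T = 1)
    (hT' : T * Tᴴ = 1) {p t : κ → ℝ} (hp : ∀ i, 0 ≤ p i) (hp1 : ∑ i, p i = 1)
    (ht : ∀ i, 0 < t i) {c : ℝ} (hc : 0 < c)
    (hle : (c • conjDiag T t - conjDiag U p).PosSemidef) :
    ∑ i, p i * Real.log (p i) -
      (conjDiag U p * conjDiag T (fun i => Real.log (t i))).trace.re ≤ Real.log c := by
  have htr : (conjDiag U p * conjDiag T (fun i => Real.log (t i))).trace.re =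
      ∑ i, ∑ j, p i * overlap U T i j * Real.log (t j) := trace_conjDiag_mul_conjDiag _ _ _ _
  have hbound : ∀ i, p i * (∑ j, overlap U T i j * (t j)⁻¹) ≤ c := by
    intro i
    set s := ∑ j, overlap U T i j * (t j)⁻¹
    obtain ⟨X, hXe⟩ : ∃ X, X = conjDiag T (fun j => (t j)⁻¹) := ⟨_, rfl⟩
    have hX : Xᴴ = X := hXe ▸ conjDiag_isHermitian _ _
    have hs : (Uᴴ * X * U) i i = (s : ℂ) := hXe ▸ conjTranspose_conjDiag_diag U T _ i
    have hXtX : X * conjDiag T t * X = X := by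
      rw [hXe, conjDiag_mul hT, conjDiag_mul hT]
      congr 1
      ext j
      rw [inv_mul_cancel₀ (ht j).ne', one_mul]
    have h0 := (hle.conjTranspose_mul_mul_same (X * U)).diag_nonneg (i := i)
    have e : (X * U)ᴴ * (c • conjDiag T t - conjDiag U p) * (X * U) =
        c • (Uᴴ * X * U) - conjDiag (Uᴴ * X * U) p := by
      have e1 : Uᴴ * X * conjDiag T t * (X * U) = Uᴴ * X * U := by
        calc _ = Uᴴ * (X * conjDiag T t * X) * U := by simp only [Matrix.mul_assoc]
          _ = _ := by rw [hXtX]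
      have e2 : Uᴴ * X * conjDiag U p * (X * U) = conjDiag (Uᴴ * X * U) p := by
        simp only [conjDiag, Matrix.conjTranspose_mul, hX, Matrix.conjTranspose_conjTranspose,
          Matrix.mul_assoc]
      rw [Matrix.conjTranspose_mul, hX, Matrix.mul_sub, Matrix.sub_mul, Matrix.mul_smul,
        Matrix.smul_mul, e1, e2]
    rw [e, Matrix.sub_apply, Matrix.smul_apply, hs, conjDiag_apply_sum] at h0
    have h1 := (Complex.le_def.1 h0).1
    have h2 : (∑ k, (p k : ℂ) * ((Uᴴ * X * U) i k * star ((Uᴴ * X * U) i k))).re =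
        ∑ k, p k * Complex.normSq ((Uᴴ * X * U) i k) := by
      rw [Complex.re_sum]
      refine Finset.sum_congr rfl fun k _ => ?_
      rw [Complex.re_ofReal_mul]
      change p k * ((Uᴴ * X * U) i k * (starRingEnd ℂ) ((Uᴴ * X * U) i k)).re = _
      rw [Complex.mul_conj, Complex.ofReal_re]
    have h3 : p i * (s * s) ≤ ∑ k, p k * Complex.normSq ((Uᴴ * X * U) i k) := by
      refine le_trans (le_of_eq ?_) (Finset.single_le_sum (f := fun k => p k *
        Complex.normSq ((Uᴴ * X * U) i k)) (fun k _ => mul_nonneg (hp k) (Complex.normSq_nonneg _))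
        (Finset.mem_univ i))
      simp only [hs, Complex.normSq_ofReal]
    rw [Complex.sub_re, h2, Complex.zero_re, Complex.real_smul, Complex.re_ofReal_mul,
      Complex.ofReal_re] at h1
    have hs0 : 0 ≤ s := Finset.sum_nonneg fun j _ =>
      mul_nonneg (overlap_nonneg _ _ _ _) (inv_nonneg.2 (ht j).le)
    rcases hs0.eq_or_lt with h | h
    · rw [← h, mul_zero]; exact hc.le
    · have : (p i * s) * s ≤ c * s := by nlinarith
      exact le_of_mul_le_mul_right this h
  rw [htr, ← Finset.sum_sub_distrib]
  calc _ ≤ ∑ i, p i * Real.log c := by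
        refine Finset.sum_le_sum fun i _ => ?_
        rcases (hp i).eq_or_lt with h | h
        · simp [← h]
        have e1 : p i * Real.log (p i) - ∑ j, p i * overlap U T i j * Real.log (t j) =
            p i * ∑ j, overlap U T i j * (Real.log (p i) - Real.log (t j)) := by
          simp only [mul_sub, Finset.sum_sub_distrib, ← Finset.sum_mul, sum_overlap_right hU hT',
            one_mul]
          rw [Finset.mul_sum]
          simp only [mul_assoc]
        rw [e1]
        refine mul_le_mul_of_nonneg_left ?_ h.le
        calc _ ≤ ∑ j, overlap U T i j * (p i * (t j)⁻¹ / c - 1 + Real.log c) := by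
              refine Finset.sum_le_sum fun j _ => mul_le_mul_of_nonneg_left ?_ (overlap_nonneg _ _ _ _)
              rw [← Real.log_div h.ne' (ht j).ne', div_eq_mul_inv]
              have hy : 0 < p i * (t j)⁻¹ := mul_pos h (inv_pos.2 (ht j))
              have := Real.log_le_sub_one_of_pos (div_pos hy hc)
              rw [Real.log_div hy.ne' hc.ne'] at this
              linarith
          _ = (p i * ∑ j, overlap U T i j * (t j)⁻¹) / c - 1 + Real.log c := by
              simp only [mul_add, mul_sub, Finset.sum_add_distrib, Finset.sum_sub_distrib,
                ← Finset.sum_mul, sum_overlap_right hU hT', one_mul]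
              congr 2
              rw [Finset.mul_sum, Finset.sum_div]
              refine Finset.sum_congr rfl fun j _ => ?_
              ring
          _ ≤ Real.log c := by
              have := (div_le_one hc).2 (hbound i)
              linarith
    _ = Real.log c := by rw [← Finset.sum_mul, hp1, one_mul]

end Pinching

section LogTests

open Matrix

variable {κ : Type*} [Fintype κ] [DecidableEq κ]

lemma suppLE_of_overlap {ρ σ : Matrix κ κ ℂ} (hρ : ρ.IsHermitian) (hσ : σ.IsHermitian)
    (h : ∀ i j, hσ.eigenvalues j = 0 → hρ.eigenvalues i *
      overlap (hρ.eigenvectorUnitary : Matrix κ κ ℂ)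
        (hσ.eigenvectorUnitary : Matrix κ κ ℂ) i j = 0) : suppLE ρ σ := by
  have hU := eigenvectorUnitary_conjTranspose_mul hρ
  have hU' := eigenvectorUnitary_mul_conjTranspose hρ
  have hV := eigenvectorUnitary_conjTranspose_mul hσ
  have hV' := eigenvectorUnitary_mul_conjTranspose hσ
  have hρe := eq_conjDiag hρ
  have hσe := eq_conjDiag hσ
  generalize hρ.eigenvalues = p at *
  generalize hσ.eigenvalues = q at *
  generalize (hρ.eigenvectorUnitary : Matrix κ κ ℂ) = U at *
  generalize (hσ.eigenvectorUnitary : Matrix κ κ ℂ) = V at *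
  have hfac : σ * (conjDiag V (fun j => (q j)⁻¹) * ρ) = ρ := by
    have e1 : Matrix.diagonal (fun j => ((q j * (q j)⁻¹ : ℝ) : ℂ)) *
        (Vᴴ * U * Matrix.diagonal (fun i => (p i : ℂ))) =
        Vᴴ * U * Matrix.diagonal (fun i => (p i : ℂ)) := by
      ext j i
      rw [Matrix.diagonal_mul, Matrix.mul_diagonal]
      by_cases hj : q j = 0
      · have h0 := h i j hj
        rw [overlap_comm] at h0
        rcases mul_eq_zero.1 h0 with h1 | h1
        · simp [h1]
        · rw [overlap, Complex.normSq_eq_zero] at h1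
          simp [h1]
      · rw [mul_inv_cancel₀ hj]
        simp
    rw [← Matrix.mul_assoc]
    conv_lhs => rw [hσe, conjDiag_mul hV, hρe]
    conv_rhs => rw [hρe]
    calc _ = V * (Matrix.diagonal (fun j => ((q j * (q j)⁻¹ : ℝ) : ℂ)) *
          (Vᴴ * U * Matrix.diagonal (fun i => (p i : ℂ)))) * Uᴴ := by
          simp only [conjDiag, Matrix.mul_assoc]
      _ = (V * Vᴴ) * U * Matrix.diagonal (fun i => (p i : ℂ)) * Uᴴ := by
          rw [e1]
          simp only [Matrix.mul_assoc]
      _ = _ := by rw [hV', Matrix.one_mul, conjDiag]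
  rintro _ ⟨x, rfl⟩
  refine ⟨(conjDiag V (fun j => (q j)⁻¹) * ρ) *ᵥ x, ?_⟩
  rw [Matrix.toLin'_apply, Matrix.toLin'_apply, Matrix.mulVec_mulVec, hfac]

lemma eigenvalues_le_one {ω : Matrix κ κ ℂ} (hω : IsState ω) (j : κ) :
    hω.1.1.eigenvalues j ≤ 1 := by
  rw [← sum_eigenvalues_of_isState hω]
  exact Finset.single_le_sum (fun i _ => hω.1.eigenvalues_nonneg i) (Finset.mem_univ j)

/-- Regularising the second argument by `δ` and letting `δ → 0`. -/
lemma relEnt_le_of_forall_pos {ρ ω : Matrix κ κ ℂ} (hρ : IsState ρ) (hω : IsState ω) {c : ℝ}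
    (h : ∀ δ : ℝ, 0 < δ → ∑ i, hρ.1.1.eigenvalues i * Real.log (hρ.1.1.eigenvalues i) -
      ∑ i, ∑ j, hρ.1.1.eigenvalues i * overlap (hρ.1.1.eigenvectorUnitary : Matrix κ κ ℂ)
        (hω.1.1.eigenvectorUnitary : Matrix κ κ ℂ) i j *
          Real.log (hω.1.1.eigenvalues j + δ) ≤ c) : relEnt ρ ω ≤ (c : EReal) := by
  have hp := hρ.1.eigenvalues_nonneg
  have hq := hω.1.eigenvalues_nonneg
  have hq1 := eigenvalues_le_one hω
  have hw0 : ∀ i j, 0 ≤ hρ.1.1.eigenvalues i * overlap (hρ.1.1.eigenvectorUnitary : Matrix κ κ ℂ)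
      (hω.1.1.eigenvectorUnitary : Matrix κ κ ℂ) i j :=
    fun i j => mul_nonneg (hp i) (overlap_nonneg _ _ _ _)
  have hw1 : ∑ i, ∑ j, hρ.1.1.eigenvalues i *
      overlap (hρ.1.1.eigenvectorUnitary : Matrix κ κ ℂ)
      (hω.1.1.eigenvectorUnitary : Matrix κ κ ℂ) i j = 1 := by
    rw [sum_overlap_mul (eigenvectorUnitary_conjTranspose_mul hρ.1.1)
      (eigenvectorUnitary_mul_conjTranspose hω.1.1), sum_eigenvalues_of_isState hρ]
  have hz : ∀ i j, hω.1.1.eigenvalues j = 0 → hρ.1.1.eigenvalues i *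
      overlap (hρ.1.1.eigenvectorUnitary : Matrix κ κ ℂ)
        (hω.1.1.eigenvectorUnitary : Matrix κ κ ℂ) i j = 0 := by
    intro i j hj
    by_contra hne
    have hpos := lt_of_le_of_ne (hw0 i j) (Ne.symm hne)
    set w : κ → κ → ℝ := fun i j => hρ.1.1.eigenvalues i *
      overlap (hρ.1.1.eigenvectorUnitary : Matrix κ κ ℂ)
        (hω.1.1.eigenvectorUnitary : Matrix κ κ ℂ) i j with hw
    set A := ∑ i, hρ.1.1.eigenvalues i * Real.log (hρ.1.1.eigenvalues i) with hA
    have hF : ∀ δ : ℝ, 0 < δ → δ ≤ 1 → ∑ i', ∑ j', w i' j' *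
        Real.log (hω.1.1.eigenvalues j' + δ) ≤ w i j * Real.log δ + Real.log 2 := by
      intro δ h0 h1
      have hl2 : 0 ≤ Real.log 2 := Real.log_nonneg (by norm_num)
      have hterm : ∀ i' j', w i' j' * Real.log (hω.1.1.eigenvalues j' + δ) ≤
          (if i' = i then if j' = j then w i j * Real.log δ else 0 else 0) +
            w i' j' * Real.log 2 := by
        intro i' j'
        have hl : Real.log (hω.1.1.eigenvalues j' + δ) ≤ Real.log 2 :=
          Real.log_le_log (add_pos_of_nonneg_of_pos (hq j') h0) (by linarith [hq1 j'])
        have hm := mul_le_mul_of_nonneg_left hl (hw0 i' j')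
        split_ifs with hi' hj'
        · subst hi' hj'
          rw [hj, zero_add]
          have := mul_nonneg (hw0 i' j') hl2
          linarith
        · linarith
        · linarith
      refine (Finset.sum_le_sum fun i' _ => Finset.sum_le_sum fun j' _ => hterm i' j').trans ?_
      simp only [Finset.sum_add_distrib, ← Finset.sum_mul]
      rw [hw1]
      simp
    have key : ∀ x : ℝ, 0 ≤ x → w i j * x ≤ c - A + Real.log 2 := by
      intro x hx
      have h1 := h (Real.exp (-x)) (Real.exp_pos _)
      have h2 := hF (Real.exp (-x)) (Real.exp_pos _) (Real.exp_le_one_iff.2 (by linarith))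
      rw [Real.log_exp] at h2
      linarith
    have h3 := key ((|c - A + Real.log 2| + 1) / w i j) (by positivity)
    rw [mul_div_cancel₀ _ hne] at h3
    linarith [le_abs_self (c - A + Real.log 2)]
  have hs : suppLE ρ ω := suppLE_of_overlap hρ.1.1 hω.1.1 hz
  rw [relEnt, if_pos hs, EReal.coe_le_coe_iff, re_trace_matLog_sub hρ.1.1 hω.1.1]
  have hlim : Tendsto (fun δ : ℝ => ∑ i, hρ.1.1.eigenvalues i *
      Real.log (hρ.1.1.eigenvalues i) -
      ∑ i, ∑ j, hρ.1.1.eigenvalues i * overlap (hρ.1.1.eigenvectorUnitary : Matrix κ κ ℂ)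
        (hω.1.1.eigenvectorUnitary : Matrix κ κ ℂ) i j *
          Real.log (hω.1.1.eigenvalues j + δ)) (𝓝[>] 0)
      (𝓝 (∑ i, hρ.1.1.eigenvalues i * Real.log (hρ.1.1.eigenvalues i) -
      ∑ i, ∑ j, hρ.1.1.eigenvalues i * overlap (hρ.1.1.eigenvectorUnitary : Matrix κ κ ℂ)
        (hω.1.1.eigenvectorUnitary : Matrix κ κ ℂ) i j * Real.log (hω.1.1.eigenvalues j))) := by
    refine tendsto_const_nhds.sub (tendsto_finsetSum _ fun i _ => tendsto_finsetSum _ fun j _ => ?_)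
    by_cases hj : hω.1.1.eigenvalues j = 0
    · rw [hz i j hj]
      simp
    · refine tendsto_const_nhds.mul ?_
      refine Tendsto.log ?_ hj
      have : Tendsto (fun δ : ℝ => hω.1.1.eigenvalues j + δ) (𝓝 0)
          (𝓝 (hω.1.1.eigenvalues j + 0)) := tendsto_const_nhds.add tendsto_id
      rw [add_zero] at this
      exact this.mono_left nhdsWithin_le_nhds
  exact le_of_tendsto hlim (by filter_upwards [self_mem_nhdsWithin] with δ hδ using h δ hδ)

/-- Hermitian matrices `H` commuting with `ω = conjDiag V q` such that `Tr exp (H + log ω) ≤ 1`,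
with `log ω` regularised. -/
def logTests (V : Matrix κ κ ℂ) (q : κ → ℝ) : Set (Matrix κ κ ℂ) :=
  {H | H.IsHermitian ∧ Commute H (conjDiag V q) ∧
    ∃ δ : ℝ, 0 < δ ∧ TraceExpLE (H + conjDiag V (fun j => Real.log (q j + δ))) 1}

lemma convex_logTests (V : Matrix κ κ ℂ) {q : κ → ℝ} (hq : ∀ j, 0 ≤ q j) :
    Convex ℝ (logTests V q) := by
  have hmono : ∀ (H : Matrix κ κ ℂ) (δ δ' : ℝ), 0 < δ' → δ' ≤ δ →
      TraceExpLE (H + conjDiag V (fun j => Real.log (q j + δ))) 1 →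
      TraceExpLE (H + conjDiag V (fun j => Real.log (q j + δ'))) 1 := by
    intro H δ δ' h0 hle h
    refine h.mono ?_
    rw [add_sub_add_left_eq_sub, conjDiag_sub]
    refine conjDiag_posSemidef V fun j => sub_nonneg.2 ?_
    exact Real.log_le_log (add_pos_of_nonneg_of_pos (hq j) h0) (by linarith)
  rintro H ⟨hH, hc, δ, hδ, hT⟩ H' ⟨hH', hc', δ', hδ', hT'⟩ a b ha hb hab
  refine ⟨?_, (hc.smul_left a).add_left (hc'.smul_left b), min δ δ', lt_min hδ hδ', ?_⟩
  · change _ᴴ = _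
    rw [Matrix.conjTranspose_add, Matrix.conjTranspose_smul, Matrix.conjTranspose_smul, hH.eq,
      hH'.eq]
    simp
  · have h1 := hmono H δ _ (lt_min hδ hδ') (min_le_left _ _) hT
    have h2 := hmono H' δ' _ (lt_min hδ hδ') (min_le_right _ _) hT'
    convert h1.combine h2 ha hb hab using 1
    rw [smul_add, smul_add, add_add_add_comm, ← add_smul, hab, one_smul]

lemma exists_eigenbasis_of_mem_logTests {V : Matrix κ κ ℂ} (hV : Vᴴ * V = 1) (hV' : V * Vᴴ = 1)
    {q : κ → ℝ} (hq : ∀ j, 0 ≤ q j) {H : Matrix κ κ ℂ} (hH : H ∈ logTests V q) :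
    ∃ (Y : Matrix κ κ ℂ) (h : κ → ℝ), Yᴴ * Y = 1 ∧ Y * Yᴴ = 1 ∧ H = conjDiag Y h ∧
      ∑ i, Real.exp (h i) * ((Yᴴ * conjDiag V q * Y) i i).re ≤ 1 := by
  obtain ⟨hH, hc, δ, hδ, hT⟩ := hH
  obtain ⟨Y, h, hY, hY', rfl⟩ : ∃ (Y : Matrix κ κ ℂ) (h : κ → ℝ), Yᴴ * Y = 1 ∧ Y * Yᴴ = 1 ∧
      H = conjDiag Y h := ⟨_, _, eigenvectorUnitary_conjTranspose_mul hH,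
    eigenvectorUnitary_mul_conjTranspose hH, eq_conjDiag hH⟩
  refine ⟨Y, h, hY, hY', rfl, ?_⟩
  have hc' := (commute_conjDiag_comp hV hV' hc.symm (fun x => Real.log (x + δ))).symm
  refine le_trans (Finset.sum_le_sum fun i _ => ?_) (hT.sum_le_of_commute hY hY' hV hV' hc')
  rw [conjTranspose_conjDiag_diag, Complex.ofReal_re, Finset.mul_sum]
  refine Finset.sum_le_sum fun j _ => ?_
  rw [Real.exp_log (add_pos_of_nonneg_of_pos (hq j) hδ), mul_assoc]
  have := overlap_nonneg Y V i j
  have := (Real.exp_pos (h i)).le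
  gcongr
  linarith

lemma relEnt_le_of_logTests {ρ ω : Matrix κ κ ℂ} (hρ : IsState ρ) (hω : IsState ω) {x : ℝ}
    (h : ∀ H ∈ logTests (hω.1.1.eigenvectorUnitary : Matrix κ κ ℂ) hω.1.1.eigenvalues,
      (ρ * H).trace.re ≤ x) :
    relEnt ρ ω ≤
      ((x + Real.log (2 * (Finset.univ.image hω.1.1.eigenvalues).card) : ℝ) : EReal) := by
  refine relEnt_le_of_forall_pos hρ hω fun δ hδ => ?_
  have hV := eigenvectorUnitary_conjTranspose_mul hω.1.1
  have hV' := eigenvectorUnitary_mul_conjTranspose hω.1.1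
  obtain ⟨T, t, hT, hT', ht, ht1, hc, hle⟩ := exists_posDef_pinching hV hV' hω.1.1.eigenvalues hρ
  have hne : Nonempty κ := by
    by_contra hn
    rw [not_nonempty_iff] at hn
    simp at ht1
  have hcard : (0 : ℝ) < 2 * (Finset.univ.image hω.1.1.eigenvalues).card := by
    have : 0 < (Finset.univ.image hω.1.1.eigenvalues).card :=
      Finset.card_pos.2 (Finset.univ_nonempty.image _)
    positivity
  set c : ℝ := 2 * (Finset.univ.image hω.1.1.eigenvalues).card
  have hle' : (c • conjDiag T t - conjDiag (hρ.1.1.eigenvectorUnitary : Matrix κ κ ℂ)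
      hρ.1.1.eigenvalues).PosSemidef := by
    rw [← eq_conjDiag hρ.1.1]
    exact hle
  have h1 := sum_mul_log_sub_le (eigenvectorUnitary_conjTranspose_mul hρ.1.1) hT hT'
    hρ.1.eigenvalues_nonneg (sum_eigenvalues_of_isState hρ) ht hcard hle'
  rw [← eq_conjDiag hρ.1.1] at h1
  have hcK := (commute_conjDiag_comp hT hT' hc.symm Real.log).symm
  have h2 := h (conjDiag T (fun i => Real.log (t i)) -
    conjDiag (hω.1.1.eigenvectorUnitary : Matrix κ κ ℂ)
      (fun j => Real.log (hω.1.1.eigenvalues j + δ))) ⟨?_, ?_, δ, hδ, ?_⟩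
  · rw [Matrix.mul_sub, Matrix.trace_sub, Complex.sub_re] at h2
    have h3 : (ρ * conjDiag (hω.1.1.eigenvectorUnitary : Matrix κ κ ℂ)
      (fun j => Real.log (hω.1.1.eigenvalues j + δ))).trace.re = ∑ i, ∑ j,
        hρ.1.1.eigenvalues i * overlap (hρ.1.1.eigenvectorUnitary : Matrix κ κ ℂ)
        (hω.1.1.eigenvectorUnitary : Matrix κ κ ℂ) i j *
          Real.log (hω.1.1.eigenvalues j + δ) := by
      rw [← trace_conjDiag_mul_conjDiag, ← eq_conjDiag hρ.1.1]
    linarith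
  · exact (conjDiag_isHermitian _ _).sub (conjDiag_isHermitian _ _)
  · exact hcK.symm.sub_left
      (commute_conjDiag_comp hV hV' (Commute.refl _) fun x => Real.log (x + δ))
  · rw [sub_add_cancel]
    refine traceExpLE_conjDiag hT hT' ?_
    simp only [Real.exp_log (ht _), ht1, le_refl]

/-- For a convex compact set of states at relative entropy more than `R` from `ω`, there is a
single observable, normalised exponentially against `ω`, whose expectation is uniformly large. -/
lemma exists_uniform_logTest {ω : Matrix κ κ ℂ} (hω : IsState ω) {C : Set (Matrix κ κ ℂ)}
    (hC : ∀ ρ ∈ C, IsState ρ) (hne : C.Nonempty) (hcomp : IsCompact C) (hconv : Convex ℝ C)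
    {R : ℝ} (hR : ∀ ρ ∈ C, (R : EReal) < relEnt ρ ω) :
    ∃ (Y : Matrix κ κ ℂ) (h : κ → ℝ), Yᴴ * Y = 1 ∧ Y * Yᴴ = 1 ∧
      ∑ i, Real.exp (h i) * ((Yᴴ * ω * Y) i i).re ≤ 1 ∧
      ∀ ρ ∈ C, R - Real.log (2 * (Finset.univ.image hω.1.1.eigenvalues).card) <
        (ρ * conjDiag Y h).trace.re := by
  have hV := eigenvectorUnitary_conjTranspose_mul hω.1.1
  have hV' := eigenvectorUnitary_mul_conjTranspose hω.1.1
  set x := R - Real.log (2 * (Finset.univ.image hω.1.1.eigenvalues).card) with hx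
  set 𝓗 := logTests (hω.1.1.eigenvectorUnitary : Matrix κ κ ℂ) hω.1.1.eigenvalues with h𝓗
  have hpt : ∀ ρ ∈ C, ∃ H ∈ 𝓗, x < (ρ * H).trace.re := by
    intro ρ hρ
    by_contra hcon
    push Not at hcon
    have := relEnt_le_of_logTests (hC ρ hρ) hω hcon
    rw [hx, sub_add_cancel] at this
    exact absurd (hR ρ hρ) (not_lt.2 this)
  have hcont1 : ∀ H : Matrix κ κ ℂ, Continuous fun ρ : Matrix κ κ ℂ => (ρ * H).trace.re :=
    fun H => Complex.continuous_re.comp ((continuous_id.matrix_mul continuous_const).matrix_trace)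
  have hcont2 : ∀ ρ : Matrix κ κ ℂ, Continuous fun H : Matrix κ κ ℂ => (ρ * H).trace.re :=
    fun ρ => Complex.continuous_re.comp ((continuous_const.matrix_mul continuous_id).matrix_trace)
  have hlin1 : ∀ H : Matrix κ κ ℂ, IsLinearMap ℝ fun ρ : Matrix κ κ ℂ => (ρ * H).trace.re :=
    fun H => ⟨fun a b => by simp [Matrix.add_mul], fun a b => by simp⟩
  have hlin2 : ∀ ρ : Matrix κ κ ℂ, IsLinearMap ℝ fun H : Matrix κ κ ℂ => (ρ * H).trace.re :=
    fun ρ => ⟨fun a b => by simp [Matrix.mul_add], fun a b => by simp⟩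
  have h𝓗c : Convex ℝ 𝓗 := convex_logTests _ hω.1.eigenvalues_nonneg
  obtain ⟨s, hs, hsY, hst⟩ : ∃ s : Set (Matrix κ κ ℂ), s.Finite ∧ s ⊆ 𝓗 ∧
      ∀ ρ ∈ C, ∃ H ∈ s, x < (ρ * H).trace.re := by
    obtain ⟨s, hs⟩ := hcomp.elim_finite_subcover
      (fun H : 𝓗 => {ρ : Matrix κ κ ℂ | x < (ρ * (H : Matrix κ κ ℂ)).trace.re})
      (fun H => isOpen_lt continuous_const (hcont1 _)) (fun ρ hρ => by
        obtain ⟨H, hH, hlt⟩ := hpt ρ hρ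
        exact Set.mem_iUnion.2 ⟨⟨H, hH⟩, hlt⟩)
    refine ⟨Subtype.val '' (s : Set 𝓗), (Finset.finite_toSet s).image _, ?_, fun ρ hρ => ?_⟩
    · rintro _ ⟨H, _, rfl⟩
      exact H.2
    · obtain ⟨H, hH⟩ := Set.mem_iUnion.1 (hs hρ)
      obtain ⟨hHs, hlt⟩ := Set.mem_iUnion.1 hH
      exact ⟨H, ⟨H, hHs, rfl⟩, hlt⟩
  obtain ⟨H, hH, hlt⟩ := Sion.exists_lt_iInf_of_lt_iInf_of_finite (X := C) (Y := 𝓗)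
    (f := fun ρ H => (ρ * H).trace.re) hne hcomp
    (fun H _ => (hcont1 H).lowerSemicontinuous.lowerSemicontinuousOn _)
    (fun H _ => ((hlin1 H).mk' _ |>.convexOn hconv).quasiconvexOn) h𝓗c
    (fun ρ _ => (hcont2 ρ).upperSemicontinuous.upperSemicontinuousOn _)
    (fun ρ _ => ((hlin2 ρ).mk' _ |>.concaveOn h𝓗c).quasiconcaveOn) hconv hs hsY hst
  obtain ⟨Y, h, hY, hY', rfl, hsum⟩ :=
    exists_eigenbasis_of_mem_logTests hV hV' hω.1.eigenvalues_nonneg hH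
  rw [← eq_conjDiag hω.1.1] at hsum
  exact ⟨Y, h, hY, hY', hsum, hlt⟩

end LogTests

section FiniteDimensional

variable {E : Type*} [AddCommGroup E] [Module ℝ E] [TopologicalSpace E] [IsTopologicalAddGroup E]
  [ContinuousSMul ℝ E] [FiniteDimensional ℝ E]

lemma isCompact_convexHull_of_finiteDimensional {K : Set E} (hK : IsCompact K) :
    IsCompact (convexHull ℝ K) := by
  set N := Module.finrank ℝ E + 1
  have himg : convexHull ℝ K = (fun p : (Fin N → ℝ) × (Fin N → E) => ∑ i, p.1 i • p.2 i) ''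
      (stdSimplex ℝ (Fin N) ×ˢ Set.univ.pi fun _ => K) := by
    ext x
    constructor
    · intro hx
      obtain ⟨ι, _, z, w, hz, hai, hw, hw1, rfl⟩ := eq_pos_convex_span_of_mem_convexHull hx
      have hcard : Fintype.card ι ≤ Fintype.card (Fin N) := by
        rw [Fintype.card_fin]
        exact hai.card_le_finrank_succ.trans (Nat.succ_le_succ (Submodule.finrank_le _))
      obtain ⟨e⟩ := Function.Embedding.nonempty_of_card_le hcard
      have hι : Nonempty ι := by
        by_contra h
        rw [not_nonempty_iff] at h
        simp at hw1
      have hout : ∀ j ∉ Set.range e, Function.extend e w 0 j = 0 := fun j hj =>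
        Function.extend_apply' _ _ _ (by simpa using hj)
      refine ⟨(Function.extend e w 0, Function.extend e z fun _ => z hι.some),
        ⟨⟨fun j => ?_, ?_⟩, fun j _ => ?_⟩, ?_⟩
      · by_cases hj : j ∈ Set.range e
        · obtain ⟨i, rfl⟩ := hj
          simp only [e.injective.extend_apply]
          exact (hw i).le
        · simp only [hout j hj, le_refl]
      · rw [← hw1]
        refine (Fintype.sum_of_injective e e.injective _ _ hout fun i => ?_).symm
        rw [e.injective.extend_apply]
      · by_cases hj : j ∈ Set.range e
        · obtain ⟨i, rfl⟩ := hj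
          simp only [e.injective.extend_apply]
          exact hz ⟨i, rfl⟩
        · simp only
          rw [Function.extend_apply' _ _ j (by simpa using hj)]
          exact hz ⟨_, rfl⟩
      · refine (Fintype.sum_of_injective e e.injective _ _ (fun j hj => ?_) fun i => ?_).symm
        · simp only [hout j hj, zero_smul]
        · simp only [e.injective.extend_apply]
    · rintro ⟨⟨w, z⟩, ⟨hw, hz⟩, rfl⟩
      exact (convex_convexHull ℝ K).sum_mem (fun i _ => hw.1 i) hw.2
        fun i _ => subset_convexHull ℝ K (hz i (Set.mem_univ i))
  rw [himg]
  refine ((isCompact_stdSimplex ℝ (Fin N)).prod (isCompact_univ_pi fun _ => hK)).image ?_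
  exact continuous_finsetSum _ fun i _ =>
    ((continuous_apply i).comp continuous_fst).smul ((continuous_apply i).comp continuous_snd)

/-- An Auerbach-type system in a compact set: finitely many points of the set, as many as the
dimension of its span, in terms of which every point has coefficients of modulus at most one. -/
lemma exists_auerbach [T2Space E] {K : Set E} (hK : IsCompact K) :
    ∃ x : Fin (Module.finrank ℝ (Submodule.span ℝ K)) → E, (∀ i, x i ∈ K) ∧
      ∀ y ∈ K, ∃ c : Fin (Module.finrank ℝ (Submodule.span ℝ K)) → ℝ,
        (∀ i, |c i| ≤ 1) ∧ y = ∑ i, c i • x i := by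
  obtain ⟨f, hfK, hspan, hli⟩ := Submodule.exists_fun_fin_finrank_span_eq ℝ K
  generalize Module.finrank ℝ (Submodule.span ℝ K) = N at f hfK hspan hli ⊢
  set W := Submodule.span ℝ (Set.range f) with hW
  obtain ⟨φ, hφ⟩ := LinearMap.exists_extend
    ((Module.Basis.span hli).equivFun : W →ₗ[ℝ] (Fin N → ℝ))
  have hKW : ∀ y ∈ K, y ∈ W := fun y hy => by
    rw [hspan]
    exact Submodule.subset_span hy
  have hφW : ∀ y : W, φ y = (Module.Basis.span hli).equivFun y := fun y =>
    LinearMap.congr_fun hφ y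
  have hφinj : ∀ y ∈ W, ∀ z ∈ W, φ y = φ z → y = z := fun y hy z hz h => by
    have h1 := hφW ⟨y, hy⟩
    have h2 := hφW ⟨z, hz⟩
    simp only at h1 h2
    rw [h1, h2] at h
    exact congrArg Subtype.val ((Module.Basis.span hli).equivFun.injective h)
  have hφf : ∀ i, φ (f i) = Pi.single i 1 := fun i => by
    have h1 := hφW (Module.Basis.span hli i)
    rw [Module.Basis.equivFun_apply, Module.Basis.repr_self, Module.Basis.span_apply] at h1
    rw [h1]
    ext j
    rw [Finsupp.single_eq_pi_single]
  have hcont : Continuous fun x : Fin N → E => |(Matrix.of fun i => φ (x i)).det| := by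
    refine continuous_abs.comp (Continuous.matrix_det ?_)
    refine continuous_pi fun i => ?_
    exact (LinearMap.continuous_of_finiteDimensional φ).comp (continuous_apply i)
  obtain ⟨x, hx, hmax⟩ := (isCompact_univ_pi fun _ : Fin N => hK).exists_isMaxOn
    ⟨f, fun i _ => hfK i⟩ hcont.continuousOn
  have hxK : ∀ i, x i ∈ K := fun i => hx i (Set.mem_univ i)
  set A : Matrix (Fin N) (Fin N) ℝ := Matrix.of fun i => φ (x i) with hA
  have hdet : 1 ≤ |A.det| := by
    have h1 := hmax (a := f) fun i _ => hfK i
    have h2 : (Matrix.of fun i => φ (f i)) = (1 : Matrix (Fin N) (Fin N) ℝ) := by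
      ext i j
      rw [Matrix.of_apply, hφf, Matrix.one_apply, Pi.single_apply]
      simp [eq_comm]
    simp only [Set.mem_ofPred_eq] at h1
    rw [h2, Matrix.det_one, abs_one] at h1
    exact h1
  have hdet0 : A.det ≠ 0 := fun h => by rw [h, abs_zero] at hdet; linarith
  refine ⟨x, hxK, fun y hy => ⟨fun i => Matrix.cramer A.transpose (φ y) i / A.det,
    fun i => ?_, ?_⟩⟩
  · rw [abs_div, div_le_one (by linarith), Matrix.cramer_transpose_apply]
    have h1 := hmax (a := Function.update x i y) fun j _ => by
      by_cases hj : j = i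
      · subst hj; simpa using hy
      · simpa [Function.update_of_ne hj] using hxK j
    have h2 : (Matrix.of fun j => φ (Function.update x i y j)) = A.updateRow i (φ y) := by
      ext j k
      by_cases hj : j = i
      · subst hj; simp
      · simp [hj, hA]
    simp only [Set.mem_ofPred_eq] at h1
    rwa [h2] at h1
  · refine hφinj _ (hKW y hy) _ (Submodule.sum_mem _ fun i _ =>
      Submodule.smul_mem _ _ (hKW _ (hxK i))) ?_
    have h1 := Matrix.mulVec_cramer A.transpose (φ y)
    rw [Matrix.det_transpose] at h1
    ext k
    have h2 := congrFun h1 k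
    simp only [Matrix.mulVec, dotProduct, Matrix.transpose_apply, Pi.smul_apply,
      smul_eq_mul, hA, Matrix.of_apply] at h2
    rw [map_sum, Finset.sum_apply]
    simp only [map_smul, Pi.smul_apply, smul_eq_mul]
    have h3 : ∀ i, Matrix.cramer A.transpose (φ y) i / A.det * φ (x i) k =
      (φ (x i) k * Matrix.cramer A.transpose (φ y) i) / A.det := fun i => by ring
    simp only [h3, ← Finset.sum_div]
    rw [eq_div_iff hdet0, mul_comm, ← h2]

end FiniteDimensional

section PermutationInvariance

lemma exists_perm_of_card_fiber_eq {α β : Type*} [Fintype α] {f g : α → β}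
    (h : ∀ b, (Finset.univ.filter fun a => f a = b).card =
      (Finset.univ.filter fun a => g a = b).card) :
    ∃ π : Equiv.Perm α, g ∘ π = f := by
  have e : ∀ b, Nonempty ({a // f a = b} ≃ {a // g a = b}) := fun b => by
    rw [← Fintype.card_eq, Fintype.card_subtype, Fintype.card_subtype]
    exact h b
  exact ⟨Equiv.ofFiberEquiv fun b => (e b).some, funext fun a => Equiv.ofFiberEquiv_map _ a⟩

/-- The algebra of `n`-copy matrices invariant under permutations of the tensor factors. -/
def permInvariant (ι : Type*) [Fintype ι] [DecidableEq ι] (n : ℕ) : Subalgebra ℂ (MatN ι n) where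
  carrier := {M | ∀ (π : Equiv.Perm (Fin n)) (i j), M (i ∘ π) (j ∘ π) = M i j}
  mul_mem' := fun {A B} hA hB π i j => by
    rw [Matrix.mul_apply, Matrix.mul_apply]
    refine (Fintype.sum_equiv (π.symm.arrowCongr (Equiv.refl ι)) _ _ fun k => ?_).symm
    have hk : (π.symm.arrowCongr (Equiv.refl ι)) k = k ∘ π := by
      ext t; simp [Equiv.arrowCongr]
    rw [hk, hA, hB]
  add_mem' := fun {A B} hA hB π i j => by
    rw [Matrix.add_apply, Matrix.add_apply, hA, hB]
  algebraMap_mem' := fun r π i j => by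
    rw [Matrix.algebraMap_matrix_apply, Matrix.algebraMap_matrix_apply]
    have hk : i ∘ π = j ∘ π ↔ i = j := π.surjective.injective_comp_right.eq_iff
    simp only [hk]

variable {ι : Type*} [Fintype ι] [DecidableEq ι]

lemma finrank_permInvariant_le (n : ℕ) :
    Module.finrank ℂ (permInvariant ι n) ≤ (n + 1) ^ Fintype.card (ι × ι) := by
  let P : (ι × ι → Fin (n + 1)) → (Fin n → ι × ι) → Prop := fun c x =>
    ∀ a, (Finset.univ.filter fun t => x t = a).card = (c a : ℕ)
  let Φ : permInvariant ι n →ₗ[ℂ] ((ι × ι → Fin (n + 1)) → ℂ) :=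
    { toFun := fun M c => if h : ∃ x, P c x then
        (M : MatN ι n) (fun t => (h.choose t).1) fun t => (h.choose t).2 else 0
      map_add' := fun M N => by
        ext c
        by_cases h : ∃ x, P c x
        · simp [h]
        · simp [h]
      map_smul' := fun r M => by
        ext c
        by_cases h : ∃ x, P c x
        · simp [h]
        · simp [h] }
  have hΦ : Function.Injective Φ := by
    rw [← LinearMap.ker_eq_bot, LinearMap.ker_eq_bot']
    intro M hM
    refine Subtype.ext (Matrix.ext fun i j => ?_)
    let x : Fin n → ι × ι := fun t => (i t, j t)
    let c : ι × ι → Fin (n + 1) := fun a =>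
      ⟨(Finset.univ.filter fun t => x t = a).card, Nat.lt_succ_of_le
        ((Finset.card_le_univ _).trans (Fintype.card_fin n).le)⟩
    have hx : ∃ x, P c x := ⟨x, fun a => rfl⟩
    obtain ⟨π, hπ⟩ := exists_perm_of_card_fiber_eq (f := hx.choose) (g := x)
      fun a => by convert hx.choose_spec a
    have h1 : Φ M c = 0 := by rw [hM]; rfl
    have h2 : Φ M c = (M : MatN ι n) (fun t => (hx.choose t).1) fun t => (hx.choose t).2 :=
      dif_pos hx
    rw [h2, ← hπ] at h1
    have h3 := M.2 π i j
    exact h3.symm.trans h1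
  have h := LinearMap.finrank_le_finrank_of_injective hΦ
  rwa [Module.finrank_pi, Fintype.card_fun, Fintype.card_fin] at h

lemma card_eigenvalues_le_finrank {κ : Type*} [Fintype κ] [DecidableEq κ]
    (S : Subalgebra ℂ (Matrix κ κ ℂ)) {A : Matrix κ κ ℂ} (hA : A.IsHermitian) (hAS : A ∈ S) :
    (Finset.univ.image hA.eigenvalues).card ≤ Module.finrank ℂ S := by
  rcases isEmpty_or_nonempty κ with hκ | hκ
  · simp
  let a : S := ⟨A, hAS⟩
  have hp : Polynomial.aeval A (minpoly ℂ a) = 0 := by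
    have h := congrArg S.val (minpoly.aeval ℂ a)
    rwa [← Polynomial.aeval_algHom_apply, map_zero] at h
  have hp0 : minpoly ℂ a ≠ 0 := minpoly.ne_zero (Algebra.IsIntegral.isIntegral a)
  have hroot : ∀ i, (hA.eigenvalues i : ℂ) ∈ (minpoly ℂ a).roots.toFinset := fun i => by
    rw [Multiset.mem_toFinset, Polynomial.mem_roots hp0, Polynomial.IsRoot.def]
    have h1 : (hA.eigenvalues i : ℂ) ∈ spectrum ℂ A := by
      rw [hA.spectrum_eq_image_range]
      exact ⟨_, ⟨i, rfl⟩, rfl⟩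
    have h2 := spectrum.subset_polynomial_aeval A (minpoly ℂ a) ⟨_, h1, rfl⟩
    rw [hp, spectrum.zero_eq] at h2
    exact h2
  calc (Finset.univ.image hA.eigenvalues).card
      = ((Finset.univ.image hA.eigenvalues).image ((↑) : ℝ → ℂ)).card :=
        (Finset.card_image_of_injective _ Complex.ofReal_injective).symm
    _ ≤ (minpoly ℂ a).roots.toFinset.card := by
        refine Finset.card_le_card fun z hz => ?_
        simp only [Finset.mem_image, Finset.mem_univ, true_and, exists_exists_eq_and] at hz
        obtain ⟨i, rfl⟩ := hz
        exact hroot i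
    _ ≤ (minpoly ℂ a).roots.card := Multiset.toFinset_card_le _
    _ ≤ (minpoly ℂ a).natDegree := Polynomial.card_roots' _
    _ ≤ Module.finrank ℂ S := minpoly.natDegree_le a

lemma tensorPow_mem_permInvariant (σ : MatC ι) (n : ℕ) : tensorPow σ n ∈ permInvariant ι n :=
  fun π i j => Equiv.prod_comp π fun t => σ (i t) (j t)

lemma iidMix_mem_permInvariant {C : Set (MatC ι)} (μ : Measure ↥C) (n : ℕ) :
    iidMix μ n ∈ permInvariant ι n := fun π i j => by
  refine integral_congr_ae (Eventually.of_forall fun σ => ?_)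
  exact Equiv.prod_comp π fun t => (σ : MatC ι) (i t) (j t)

lemma finrank_span_iidSet_le (F : Set (MatC ι)) (n : ℕ) :
    Module.finrank ℝ (Submodule.span ℝ (iidSet F n)) ≤ 2 * (n + 1) ^ Fintype.card (ι × ι) := by
  have h : Submodule.span ℝ (iidSet F n) ≤
      (Subalgebra.toSubmodule (permInvariant ι n)).restrictScalars ℝ := by
    refine Submodule.span_le.2 ?_
    rintro _ ⟨σ, -, rfl⟩
    exact tensorPow_mem_permInvariant σ n
  refine (Submodule.finrank_mono h).trans ?_
  have h2 := finrank_real_of_complex (permInvariant ι n)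
  exact h2.le.trans (Nat.mul_le_mul_left 2 (finrank_permInvariant_le n))

end PermutationInvariance

section TensorProducts

open Matrix

lemma tensorProdFam_mul {ι : Type*} [Fintype ι] {n : ℕ} (f g : Fin n → MatC ι) :
    tensorProdFam f * tensorProdFam g = tensorProdFam fun k => f k * g k := by
  ext i j
  simp only [tensorProdFam, Matrix.mul_apply, Finset.prod_univ_sum, Fintype.piFinset_univ,
    ← Finset.prod_mul_distrib]

lemma tensorProdFam_conjTranspose {ι : Type*} {n : ℕ} (f : Fin n → MatC ι) :
    (tensorProdFam f)ᴴ = tensorProdFam fun k => (f k)ᴴ := by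
  ext i j
  simp only [tensorProdFam, Matrix.conjTranspose_apply, star_prod]

lemma trace_tensorProdFam {ι : Type*} [Fintype ι] {n : ℕ} (f : Fin n → MatC ι) :
    (tensorProdFam f).trace = ∏ k, (f k).trace := by
  simp only [tensorProdFam, Matrix.trace, Matrix.diag_apply, Finset.prod_univ_sum,
    Fintype.piFinset_univ]

lemma tensorProdFam_one {ι : Type*} [DecidableEq ι] {n : ℕ} :
    tensorProdFam (fun _ : Fin n => (1 : MatC ι)) = 1 := by
  ext i j
  simp only [tensorProdFam, Matrix.one_apply, Finset.prod_boole, Finset.mem_univ, true_imp_iff,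
    funext_iff]

variable {ι : Type*} [Fintype ι] [DecidableEq ι] {n : ℕ}

lemma tensorProdFam_conjDiag (U : Fin n → MatC ι) (p : Fin n → ι → ℝ) :
    tensorProdFam (fun k => conjDiag (U k) (p k)) =
      conjDiag (tensorProdFam U) fun x => ∏ k, p k (x k) := by
  ext i j
  rw [conjDiag_apply_sum]
  simp only [tensorProdFam, conjDiag_apply_sum, Finset.prod_univ_sum, Fintype.piFinset_univ,
    Finset.prod_mul_distrib, star_prod, Complex.ofReal_prod]

lemma posSemidef_tensorProdFam {f : Fin n → MatC ι} (hf : ∀ k, (f k).PosSemidef) :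
    (tensorProdFam f).PosSemidef := by
  have h : f = fun k => conjDiag ((hf k).1.eigenvectorUnitary : MatC ι) (hf k).1.eigenvalues :=
    funext fun k => eq_conjDiag (hf k).1
  rw [h, tensorProdFam_conjDiag]
  exact conjDiag_posSemidef _ fun x => Finset.prod_nonneg fun k _ => (hf k).eigenvalues_nonneg _

lemma isState_tensorProdFam {f : Fin n → MatC ι} (hf : ∀ k, IsState (f k)) :
    IsState (tensorProdFam f) := by
  refine ⟨posSemidef_tensorProdFam fun k => (hf k).1, ?_⟩
  rw [trace_tensorProdFam]
  exact Finset.prod_eq_one fun k _ => (hf k).2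

lemma isState_tensorPow {σ : MatC ι} (hσ : IsState σ) (n : ℕ) : IsState (tensorPow σ n) :=
  isState_tensorProdFam fun _ => hσ

lemma convex_isState {κ : Type*} [Fintype κ] : Convex ℝ {ρ : Matrix κ κ ℂ | IsState ρ} := by
  intro ρ hρ σ hσ a b ha hb hab
  refine ⟨(hρ.1.smul ha).add (hσ.1.smul hb), ?_⟩
  rw [Matrix.trace_add, Matrix.trace_smul, Matrix.trace_smul, hρ.2, hσ.2, ← add_smul, hab,
    one_smul]

lemma isState_of_mem_convexHull_avSet {F : Set (MatC ι)} (hF : ∀ ρ ∈ F, IsState ρ)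
    {ρ : MatN ι n} (hρ : ρ ∈ convexHull ℝ (avSet F n)) : IsState ρ := by
  refine convexHull_min ?_ convex_isState hρ
  rintro _ ⟨f, hf, rfl⟩
  exact isState_tensorProdFam fun k => hF _ (hf k)

lemma norm_apply_le_one_of_isState {ρ : MatC ι} (hρ : IsState ρ) (i j : ι) : ‖ρ i j‖ ≤ 1 := by
  have h := eq_conjDiag hρ.1.1
  have hU := fun i j => entry_norm_bound_of_unitary hρ.1.1.eigenvectorUnitary.2 i j
  have h1 := sum_eigenvalues_of_isState hρ
  have h2 := fun k => hρ.1.eigenvalues_nonneg k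
  rw [congrFun (congrFun h i) j, conjDiag_apply_sum]
  refine (norm_sum_le _ _).trans ?_
  rw [← h1]
  refine Finset.sum_le_sum fun k _ => ?_
  rw [norm_mul, norm_mul, norm_star, Complex.norm_real, Real.norm_of_nonneg (h2 k)]
  exact mul_le_of_le_one_right (h2 k) (mul_le_one₀ (hU i k) (norm_nonneg _) (hU j k))

lemma isCompact_of_isClosed_of_isState {F : Set (MatC ι)} (hF : ∀ ρ ∈ F, IsState ρ)
    (hcl : IsClosed F) : IsCompact F := by
  have h : IsCompact (Set.univ.pi fun _ : ι => Set.univ.pi fun _ : ι =>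
      Metric.closedBall (0 : ℂ) 1) :=
    isCompact_univ_pi fun _ => isCompact_univ_pi fun _ => isCompact_closedBall _ _
  refine IsCompact.of_isClosed_subset h hcl fun ρ hρ i _ j _ => ?_
  rw [mem_closedBall_zero_iff]
  exact norm_apply_le_one_of_isState (hF ρ hρ) i j

lemma continuous_tensorProdFam {ι : Type*} {n : ℕ} :
    Continuous (tensorProdFam : (Fin n → MatC ι) → MatN ι n) := by
  refine continuous_matrix fun i j => continuous_finsetProd _ fun k _ => ?_
  exact (continuous_apply k).matrix_elem (i k) (j k)

lemma isCompact_avSet {ι : Type*} {F : Set (MatC ι)} (hF : IsCompact F) (n : ℕ) : IsCompact (avSet F n) := by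
  have h : avSet F n = tensorProdFam '' Set.univ.pi fun _ => F := by
    ext ρ
    simp only [avSet, Set.mem_ofPred_eq, Set.mem_image, Set.mem_univ_pi, eq_comm]
  rw [h]
  exact (isCompact_univ_pi fun _ => hF).image continuous_tensorProdFam

lemma isCompact_iidSet {ι : Type*} {F : Set (MatC ι)} (hF : IsCompact F) (n : ℕ) :
    IsCompact (iidSet F n) := by
  have h : iidSet F n = (fun σ => tensorProdFam fun _ => σ) '' F := by
    ext ρ
    simp only [iidSet, Set.mem_ofPred_eq, Set.mem_image, eq_comm]
    rfl
  rw [h]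
  exact hF.image (continuous_tensorProdFam.comp (continuous_pi fun _ => continuous_id))

lemma avSet_nonempty {ι : Type*} {F : Set (MatC ι)} (hF : F.Nonempty) (n : ℕ) : (avSet F n).Nonempty :=
  ⟨_, fun _ => hF.some, fun _ => hF.some_mem, rfl⟩

end TensorProducts

section Mixtures

open Matrix

variable {ι : Type*} [Fintype ι] [DecidableEq ι] {F : Set (MatC ι)}

lemma posSemidef_of_re_trace {κ : Type*} [Fintype κ] {M : Matrix κ κ ℂ} (hM : M.IsHermitian)
    (h : ∀ E : Matrix κ κ ℂ, E.PosSemidef → 0 ≤ (M * E).trace.re) : M.PosSemidef := by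
  refine Matrix.PosSemidef.of_dotProduct_mulVec_nonneg hM fun x => ?_
  have h1 := h _ (Matrix.posSemidef_vecMulVec_self_star x)
  rw [Matrix.mul_vecMulVec, Matrix.trace_vecMulVec, dotProduct_comm] at h1
  rw [Complex.nonneg_iff]
  refine ⟨h1, ?_⟩
  exact (hM.im_star_dotProduct_mulVec_self x).symm

lemma integrable_tensorPow_apply (hF : ∀ σ ∈ F, IsState σ) (μ : Measure ↥F) [IsFiniteMeasure μ]
    (n : ℕ) (i j : Fin n → ι) : Integrable (fun σ : ↥F => tensorPow (σ : MatC ι) n i j) μ := by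
  refine Integrable.of_bound (Measurable.aestronglyMeasurable ?_) 1
    (Eventually.of_forall fun σ => norm_apply_le_one_of_isState (isState_tensorPow (hF σ σ.2) n) i j)
  refine Finset.measurable_prod _ fun k _ => ?_
  exact (measurable_pi_apply (j k)).comp ((measurable_pi_apply (i k)).comp measurable_subtype_coe)

lemma integrable_re_trace_tensorPow_mul (hF : ∀ σ ∈ F, IsState σ) (μ : Measure ↥F)
    [IsFiniteMeasure μ] (n : ℕ) (E : MatN ι n) :
    Integrable (fun σ : ↥F => (tensorPow (σ : MatC ι) n * E).trace.re) μ := by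
  simp only [Matrix.trace, Matrix.diag_apply, Matrix.mul_apply]
  exact (integrable_finsetSum _ fun i _ => integrable_finsetSum _ fun j _ =>
    (integrable_tensorPow_apply hF μ n i j).mul_const _).re

lemma re_trace_iidMix_mul (hF : ∀ σ ∈ F, IsState σ) (μ : Measure ↥F) [IsFiniteMeasure μ]
    (n : ℕ) (E : MatN ι n) :
    (iidMix μ n * E).trace.re = ∫ σ : ↥F, (tensorPow (σ : MatC ι) n * E).trace.re ∂μ := by
  have hint : ∀ i j, Integrable (fun σ : ↥F => tensorPow (σ : MatC ι) n i j * E j i) μ :=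
    fun i j => (integrable_tensorPow_apply hF μ n i j).mul_const _
  have h : (iidMix μ n * E).trace = ∫ σ : ↥F, (tensorPow (σ : MatC ι) n * E).trace ∂μ := by
    simp only [Matrix.trace, Matrix.diag_apply, Matrix.mul_apply]
    rw [integral_finsetSum _ fun i _ => integrable_finsetSum _ fun j _ => hint i j]
    refine Finset.sum_congr rfl fun i _ => ?_
    rw [integral_finsetSum _ fun j _ => hint i j]
    refine Finset.sum_congr rfl fun j _ => ?_
    rw [integral_mul_const]
    rfl
  rw [h]
  refine (integral_re (𝕜 := ℂ) ?_).symm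
  simp only [Matrix.trace, Matrix.diag_apply, Matrix.mul_apply]
  exact integrable_finsetSum _ fun i _ => integrable_finsetSum _ fun j _ => hint i j

lemma iidMix_isHermitian (hF : ∀ σ ∈ F, IsState σ) (μ : Measure ↥F) (n : ℕ) :
    (iidMix μ n).IsHermitian := by
  ext i j
  rw [Matrix.conjTranspose_apply]
  refine (integral_conj (𝕜 := ℂ)).symm.trans
    (integral_congr_ae (Eventually.of_forall fun σ => ?_))
  exact (isState_tensorPow (hF σ σ.2) n).1.1.apply i j

lemma isState_iidMix (hF : ∀ σ ∈ F, IsState σ) (μ : Measure ↥F) [IsProbabilityMeasure μ]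
    (n : ℕ) : IsState (iidMix μ n) := by
  have h1 := iidMix_isHermitian hF μ n
  refine ⟨posSemidef_of_re_trace h1 fun E hE => ?_, ?_⟩
  · rw [re_trace_iidMix_mul hF]
    exact integral_nonneg fun σ => re_trace_mul_nonneg (isState_tensorPow (hF σ σ.2) n).1 hE
  · refine Complex.ext ?_ ?_
    · have h2 := re_trace_iidMix_mul hF μ n 1
      simp only [mul_one] at h2
      rw [h2]
      have h3 : ∀ σ : ↥F, (tensorPow (σ : MatC ι) n).trace.re = 1 := fun σ => by
        rw [(isState_tensorPow (hF σ σ.2) n).2, Complex.one_re]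
      simp [h3]
    · have h2 := congrArg Complex.im (congrArg Matrix.trace h1.eq)
      rw [Matrix.trace_conjTranspose, Complex.star_def, Complex.conj_im] at h2
      rw [Complex.one_im]
      linarith

end Mixtures

section UniversalMixture

variable {ι : Type*} [Fintype ι] [DecidableEq ι] {F : Set (MatC ι)}

lemma exists_dominating_measure (hF : ∀ σ ∈ F, IsState σ) (hne : F.Nonempty) (hcomp : IsCompact F)
    (n : ℕ) : ∃ μ : Measure ↥F, IsProbabilityMeasure μ ∧ ∀ σ ∈ F, ∀ E : MatN ι n, E.PosSemidef →
      (tensorPow σ n * E).trace.re ≤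
        2 * (n + 1) ^ Fintype.card (ι × ι) * (iidMix μ n * E).trace.re := by
  obtain ⟨x, hx, hK⟩ := exists_auerbach (isCompact_iidSet hcomp n)
  have hrank := finrank_span_iidSet_le F n
  generalize Module.finrank ℝ (Submodule.span ℝ (iidSet F n)) = N at x hx hK hrank
  choose s hsF hs using hx
  have hN : N ≠ 0 := by
    rintro rfl
    obtain ⟨σ, hσ⟩ := hne
    obtain ⟨c, -, hc⟩ := hK _ ⟨σ, hσ, rfl⟩
    have h := (isState_tensorPow (hF σ hσ) n).2
    rw [hc] at h
    simp at h
  let μ : Measure ↥F := (N : ENNReal)⁻¹ • ∑ i, Measure.dirac ⟨s i, hsF i⟩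
  have hμ : IsProbabilityMeasure μ := ⟨by
    simp only [μ, Measure.smul_apply, Measure.finsetSum_apply, measure_univ, smul_eq_mul,
      Finset.sum_const, Finset.card_univ, Fintype.card_fin, nsmul_eq_mul, mul_one]
    exact ENNReal.inv_mul_cancel (by exact_mod_cast hN) (ENNReal.natCast_ne_top N)⟩
  refine ⟨μ, hμ, fun σ hσ E hE => ?_⟩
  have hmix : (iidMix μ n * E).trace.re = (N : ℝ)⁻¹ * ∑ i, (x i * E).trace.re := by
    rw [re_trace_iidMix_mul hF, integral_smul_measure,
      integral_finsetSum_measure fun i _ => integrable_re_trace_tensorPow_mul hF _ n E,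
      ENNReal.toReal_inv, ENNReal.toReal_natCast, smul_eq_mul]
    congr 1
    refine Finset.sum_congr rfl fun i _ => ?_
    rw [hs i]
    refine integral_dirac' _ _ (Measurable.stronglyMeasurable ?_)
    refine Complex.measurable_re.comp ?_
    simp only [Matrix.trace, Matrix.diag_apply, Matrix.mul_apply]
    refine Finset.measurable_sum _ fun i _ => Finset.measurable_sum _ fun j _ =>
      Measurable.mul_const (Finset.measurable_prod _ fun k _ => ?_) _
    exact (measurable_pi_apply (j k)).comp
      ((measurable_pi_apply (i k)).comp measurable_subtype_coe)
  have hpos : ∀ i, 0 ≤ (x i * E).trace.re := fun i => by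
    rw [hs i]
    exact re_trace_mul_nonneg (isState_tensorPow (hF _ (hsF i)) n).1 hE
  obtain ⟨c, hc, hy⟩ := hK _ ⟨σ, hσ, rfl⟩
  have h1 : (tensorPow σ n * E).trace.re ≤ ∑ i, (x i * E).trace.re := by
    rw [hy, Finset.sum_mul, Matrix.trace_sum, Complex.re_sum]
    refine Finset.sum_le_sum fun i _ => ?_
    rw [Matrix.smul_mul, Matrix.trace_smul, Complex.smul_re, smul_eq_mul]
    exact mul_le_of_le_one_left (hpos i) ((le_abs_self _).trans (hc i))
  have hN' : (0 : ℝ) < N := by exact_mod_cast Nat.pos_of_ne_zero hN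
  have h2 : ∑ i, (x i * E).trace.re = N * (iidMix μ n * E).trace.re := by
    rw [hmix, mul_inv_cancel_left₀ hN'.ne']
  have h3 : 0 ≤ (iidMix μ n * E).trace.re :=
    re_trace_mul_nonneg (isState_iidMix hF μ n).1 hE
  rw [h2] at h1
  exact h1.trans (mul_le_mul_of_nonneg_right (by exact_mod_cast hrank) h3)

/-- A single mixing measure whose i.i.d. mixtures dominate all i.i.d. states up to a polynomial
factor. -/
lemma exists_universal_measure (hF : ∀ σ ∈ F, IsState σ) (hne : F.Nonempty)
    (hcomp : IsCompact F) : ∃ μ : Measure ↥F, IsProbabilityMeasure μ ∧ ∃ (C : ℝ) (D : ℕ), 0 < C ∧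
      ∀ n, ∀ σ ∈ F, ∀ E : MatN ι n, E.PosSemidef →
        (tensorPow σ n * E).trace.re ≤ C * (n + 1) ^ D * (iidMix μ n * E).trace.re := by
  choose ν hν hdom using exists_dominating_measure hF hne hcomp
  let w : ℕ → ENNReal := fun n => ENNReal.ofReal (1 / ((n : ℝ) + 1) ^ 2)
  have hw : ∀ n, w n ≠ 0 := fun n => (ENNReal.ofReal_pos.2 (by positivity)).ne'
  have hw0 : tsum w ≠ 0 := fun h => hw 0 (ENNReal.tsum_eq_zero.1 h 0)
  have hwt : tsum w ≠ ⊤ := by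
    refine Summable.tsum_ofReal_ne_top ?_
    have h := (summable_nat_add_iff 1).2 (Real.summable_one_div_nat_pow.2 one_lt_two)
    exact_mod_cast h
  let p := PMF.normalize w hw0 hwt
  let μ : Measure ↥F := Measure.sum fun n => p n • ν n
  have hμ : IsProbabilityMeasure μ := ⟨by
    simp only [μ, Measure.sum_apply _ MeasurableSet.univ, Measure.smul_apply, measure_univ,
      smul_eq_mul, mul_one, PMF.tsum_coe]⟩
  have hT : 0 < (tsum w).toReal := ENNReal.toReal_pos hw0 hwt
  refine ⟨μ, hμ, 2 * (tsum w).toReal, Fintype.card (ι × ι) + 2, by positivity,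
    fun n σ hσ E hE => ?_⟩
  have h1 := hdom n σ hσ E hE
  have h2 : (p n).toReal * (iidMix (ν n) n * E).trace.re ≤ (iidMix μ n * E).trace.re := by
    rw [re_trace_iidMix_mul hF, re_trace_iidMix_mul hF, ← smul_eq_mul, ← integral_smul_measure]
    exact integral_mono_measure (Measure.le_sum (fun n => p n • ν n) n)
      (Eventually.of_forall fun σ => re_trace_mul_nonneg (isState_tensorPow (hF σ σ.2) n).1 hE)
      (integrable_re_trace_tensorPow_mul hF _ n E)
  have hp : (p n).toReal = 1 / ((n : ℝ) + 1) ^ 2 * (tsum w).toReal⁻¹ := by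
    simp only [p, PMF.normalize_apply, ENNReal.toReal_mul, ENNReal.toReal_inv, w]
    rw [ENNReal.toReal_ofReal (by positivity)]
  rw [hp] at h2
  refine h1.trans ?_
  have h3 : (iidMix (ν n) n * E).trace.re ≤
      ((n : ℝ) + 1) ^ 2 * (tsum w).toReal * (iidMix μ n * E).trace.re := by
    have h4 := mul_le_mul_of_nonneg_left h2
      (show 0 ≤ ((n : ℝ) + 1) ^ 2 * (tsum w).toReal by positivity)
    refine le_trans (le_of_eq ?_) h4
    field_simp
  refine (mul_le_mul_of_nonneg_left h3 (by positivity)).trans (le_of_eq ?_)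
  rw [pow_add]
  ring

end UniversalMixture

section BlockTests

open Matrix

variable {ι : Type*} [Fintype ι] [DecidableEq ι]

/-- A test on `m` blocks of `k` copies each lifts to a test on `n` copies, whenever the copies are
partitioned into these blocks and a remainder. -/
lemma exists_lift_test {n m k r : ℕ} (e : (Fin m × Fin k) ⊕ Fin r ≃ Fin n)
    {T : MatN (Fin k → ι) m} (hT : T.PosSemidef) (hT' : (1 - T).PosSemidef) :
    ∃ E : MatN ι n, E.PosSemidef ∧ (1 - E).PosSemidef ∧
      ∀ f : Fin n → MatC ι, (∀ p, IsState (f p)) →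
        (tensorProdFam f * E).trace =
          (tensorProdFam (fun b => tensorProdFam fun t => f (e (Sum.inl (b, t)))) * T).trace := by
  let a : (Fin n → ι) ≃ (Fin m → Fin k → ι) × (Fin r → ι) :=
    ((e.arrowCongr (Equiv.refl ι)).symm.trans (Equiv.sumArrowEquivProdArrow _ _ _)).trans
      ((Equiv.curry _ _ _).prodCongr (Equiv.refl _))
  let L : MatN (Fin k → ι) m → MatN ι n := fun M =>
    (kroneckerMap (· * ·) M (1 : MatN ι r)).submatrix a a
  have hL : ∀ {M}, M.PosSemidef → (L M).PosSemidef := fun {M} hM =>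
    (hM.kronecker Matrix.PosSemidef.one).submatrix a
  have hL1 : 1 - L T = L (1 - T) := by
    ext i j
    simp only [L, Matrix.sub_apply, Matrix.submatrix_apply, kroneckerMap_apply, sub_mul]
    congr 1
    have h := congrFun (congrFun (congrArg (fun M => M.submatrix a a)
      (one_kronecker_one (α := ℂ) (m := Fin m → Fin k → ι) (n := Fin r → ι))) i) j
    rw [submatrix_one_equiv] at h
    exact h.symm
  refine ⟨L T, hL hT, hL1 ▸ hL hT', fun f hf => ?_⟩
  have hρ : tensorProdFam f = (kroneckerMap (· * ·)
      (tensorProdFam (fun b => tensorProdFam fun t => f (e (Sum.inl (b, t)))))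
      (tensorProdFam fun t => f (e (Sum.inr t)))).submatrix a a := by
    ext i j
    simp only [tensorProdFam, Matrix.submatrix_apply, kroneckerMap_apply]
    rw [← e.prod_comp, Fintype.prod_sum_type, Fintype.prod_prod_type]
    rfl
  rw [hρ, submatrix_mul_equiv, ← mul_kronecker_mul, mul_one]
  have htr : ∀ M : Matrix ((Fin m → Fin k → ι) × (Fin r → ι)) _ ℂ,
      (M.submatrix a a).trace = M.trace := fun M => a.sum_comp fun i => M i i
  rw [htr, trace_kronecker, (isState_tensorProdFam fun t => hf _).2, mul_one]

lemma re_trace_tensorProdFam_mul_conjDiag {m : ℕ} {Y : MatC ι} {f : Fin m → MatC ι}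
    (hf : ∀ b, (f b).IsHermitian) (a : (Fin m → ι) → ℝ) :
    (tensorProdFam f * conjDiag (tensorProdFam fun _ => Y) a).trace.re =
      ∑ x, a x * ∏ b, ((Yᴴ * f b * Y) (x b) (x b)).re := by
  rw [Matrix.trace_mul_comm, trace_conjDiag_mul, tensorProdFam_conjTranspose, tensorProdFam_mul,
    tensorProdFam_mul, Complex.re_sum]
  refine Finset.sum_congr rfl fun x _ => ?_
  rw [Complex.re_ofReal_mul]
  congr 1
  have h : ∀ b, (Yᴴ * f b * Y) (x b) (x b) = (((Yᴴ * f b * Y) (x b) (x b)).re : ℂ) := fun b => by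
    have h1 := (Matrix.isHermitian_conjTranspose_mul_mul Y (hf b)).apply (x b) (x b)
    exact (Complex.conj_eq_iff_re.1 h1).symm
  simp only [tensorProdFam]
  rw [Finset.prod_congr rfl fun b _ => h b, ← Complex.ofReal_prod, Complex.ofReal_re]

lemma exists_exponential_tilt {κ : Type*} [Fintype κ] (h : κ → ℝ) {t δ : ℝ} (hδ : 0 < δ) :
    ∃ s r : ℝ, 0 < s ∧ 0 ≤ r ∧ r < 1 ∧ ∀ q : κ → ℝ, (∀ i, 0 ≤ q i) → ∑ i, q i = 1 →
      t + δ ≤ ∑ i, q i * h i → ∑ i, q i * Real.exp (s * (t - h i)) ≤ r := by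
  let M : ℝ := δ + ∑ i, |t - h i|
  have hM : ∀ i, |t - h i| ≤ M := fun i => by
    have h1 := Finset.single_le_sum (f := fun i => |t - h i|) (fun i _ => abs_nonneg _)
      (Finset.mem_univ i)
    simp only [M]
    linarith
  have hδM : δ ≤ M := by
    simp only [M]
    linarith [Finset.sum_nonneg fun i (_ : i ∈ Finset.univ) => abs_nonneg (t - h i)]
  have hM0 : 0 < M := hδ.trans_le hδM
  let s := δ / (2 * M ^ 2)
  have hs : 0 < s := by positivity
  have hsM : s * M ≤ 1 / 2 := by
    simp only [s]
    rw [div_mul_eq_mul_div, div_le_iff₀ (by positivity)]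
    nlinarith
  have hsM2 : s * (s * M ^ 2) = s * δ / 2 := by
    simp only [s]
    field_simp
  have hsδ : s * δ ≤ 1 / 2 := (mul_le_mul_of_nonneg_left hδM hs.le).trans hsM
  refine ⟨s, 1 - s * δ / 2, hs, by linarith, by nlinarith [mul_pos hs hδ],
    fun q hq hq1 hmean => ?_⟩
  have h1 : ∀ i, Real.exp (s * (t - h i)) ≤ 1 + s * (t - h i) + s * δ / 2 := fun i => by
    have h2 : |s * (t - h i)| ≤ s * M := by
      rw [abs_mul, abs_of_pos hs]
      exact mul_le_mul_of_nonneg_left (hM i) hs.le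
    have h3 := (abs_le.1 (Real.abs_exp_sub_one_sub_id_le (x := s * (t - h i)) (by linarith))).2
    have h4 : (s * (t - h i)) ^ 2 ≤ (s * M) ^ 2 := sq_le_sq' (by linarith [(abs_le.1 h2).1])
      (abs_le.1 h2).2
    nlinarith
  calc ∑ i, q i * Real.exp (s * (t - h i))
      ≤ ∑ i, q i * (1 + s * (t - h i) + s * δ / 2) :=
        Finset.sum_le_sum fun i _ => mul_le_mul_of_nonneg_left (h1 i) (hq i)
    _ = (1 + s * t + s * δ / 2) * ∑ i, q i - s * ∑ i, q i * h i := by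
        rw [Finset.mul_sum, Finset.mul_sum, ← Finset.sum_sub_distrib]
        exact Finset.sum_congr rfl fun i _ => by ring
    _ ≤ 1 - s * δ / 2 := by
        rw [hq1]
        nlinarith [mul_le_mul_of_nonneg_left hmean hs.le]

lemma sum_indicator_mul_prod_le {κ : Type*} [Fintype κ] {m : ℕ} {G : (Fin m → κ) → Prop}
    [DecidablePred G]
    {q : Fin m → κ → ℝ} (hq : ∀ b i, 0 ≤ q b i) {u : κ → ℝ} {c : ℝ}
    (hG : ∀ x, G x → 0 ≤ ∑ b, u (x b)) (hc : ∀ b, ∑ i, q b i * Real.exp (u i) ≤ c) :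
    ∑ x : Fin m → κ, (if G x then 1 else 0) * ∏ b, q b (x b) ≤ c ^ m := by
  calc ∑ x : Fin m → κ, (if G x then 1 else 0) * ∏ b, q b (x b)
      ≤ ∑ x : Fin m → κ, ∏ b, q b (x b) * Real.exp (u (x b)) := by
        refine Finset.sum_le_sum fun x _ => ?_
        rw [Finset.prod_mul_distrib, ← Real.exp_sum, mul_comm]
        refine mul_le_mul_of_nonneg_left ?_ (Finset.prod_nonneg fun b _ => hq b _)
        split_ifs with h
        · exact Real.one_le_exp (hG x h)
        · exact (Real.exp_pos _).le
    _ = ∏ b, ∑ i, q b i * Real.exp (u i) := by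
        rw [Finset.prod_univ_sum, Fintype.piFinset_univ]
    _ ≤ c ^ m := by
        refine (Finset.prod_le_prod (fun b _ => Finset.sum_nonneg fun i _ =>
          mul_nonneg (hq b i) (Real.exp_pos _).le) fun b _ => hc b).trans ?_
        simp

end BlockTests

section Achievability

open Matrix

variable {ι : Type*} [Fintype ι] [DecidableEq ι]

lemma re_trace_mul_conjDiag {κ : Type*} [Fintype κ] [DecidableEq κ] (ρ Y : Matrix κ κ ℂ)
    (h : κ → ℝ) : (ρ * conjDiag Y h).trace.re = ∑ i, ((Yᴴ * ρ * Y) i i).re * h i := by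
  rw [Matrix.trace_mul_comm, trace_conjDiag_mul, Complex.re_sum]
  exact Finset.sum_congr rfl fun i _ => by rw [Complex.re_ofReal_mul, mul_comm]

lemma re_conj_diag_nonneg {κ : Type*} [Fintype κ] {ρ : Matrix κ κ ℂ} (hρ : ρ.PosSemidef)
    (Y : Matrix κ κ ℂ) (i : κ) : 0 ≤ ((Yᴴ * ρ * Y) i i).re :=
  (Complex.nonneg_iff.1 (hρ.conjTranspose_mul_mul_same Y).diag_nonneg).1

lemma exists_test_of_logTest {A1 B1 : Set (MatC ι)} (hA : ∀ ρ ∈ A1, IsState ρ)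
    (hB : ∀ σ ∈ B1, IsState σ) {k : ℕ} {Y : MatN ι k} (hY : Y * Yᴴ = 1)
    {h : (Fin k → ι) → ℝ} {t δ c : ℝ} (hδ : 0 < δ)
    (hmean : ∀ ρ ∈ avSet A1 k, t + δ ≤ (ρ * conjDiag Y h).trace.re)
    (hexp : ∀ σ ∈ B1, ∑ i, ((Yᴴ * tensorPow σ k * Y) i i).re * Real.exp (h i) ≤ c) :
    ∃ r : ℝ, 0 ≤ r ∧ r < 1 ∧ ∀ m n, m * k ≤ n → ∃ E : MatN ι n, E.PosSemidef ∧
      (1 - E).PosSemidef ∧ (∀ ρ ∈ avSet A1 n, (ρ * (1 - E)).trace.re ≤ r ^ m) ∧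
      ∀ σ ∈ iidSet B1 n, (σ * E).trace.re ≤ (c * Real.exp (-t)) ^ m := by
  obtain ⟨s, r, hs, hr, hr1, htilt⟩ := exists_exponential_tilt h (t := t) hδ
  refine ⟨r, hr, hr1, fun m n hmn => ?_⟩
  obtain ⟨l, rfl⟩ := Nat.exists_eq_add_of_le hmn
  let e : (Fin m × Fin k) ⊕ Fin l ≃ Fin (m * k + l) :=
    (finProdFinEquiv.sumCongr (Equiv.refl _)).trans finSumFinEquiv
  let W : MatN (Fin k → ι) m := tensorProdFam fun _ => Y
  have hW : W * Wᴴ = 1 := by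
    simp only [W, tensorProdFam_conjTranspose, tensorProdFam_mul, hY, tensorProdFam_one]
  let G : (Fin m → Fin k → ι) → Prop := fun x => 0 ≤ ∑ b, (h (x b) - t)
  let T : MatN (Fin k → ι) m := conjDiag W fun x => if G x then 1 else 0
  have hT : T.PosSemidef := conjDiag_posSemidef _ fun x => by split_ifs <;> norm_num
  have hT1 : 1 - T = conjDiag W fun x => if ¬ G x then 1 else 0 := by
    rw [← conjDiag_one hW, conjDiag_sub]
    congr 1
    ext x
    by_cases hx : G x <;> simp [hx]
  have hT' : (1 - T).PosSemidef := by
    rw [hT1]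
    exact conjDiag_posSemidef _ fun x => by split_ifs <;> norm_num
  obtain ⟨E, hE, hE', hlift⟩ := exists_lift_test e hT hT'
  refine ⟨E, hE, hE', ?_, ?_⟩
  · rintro _ ⟨f, hf, rfl⟩
    have hst : ∀ b, IsState (tensorProdFam fun t => f (e (Sum.inl (b, t)))) := fun b =>
      isState_tensorProdFam fun t => hA _ (hf _)
    have h1 : (tensorProdFam f * (1 - E)).trace =
        (tensorProdFam (fun b => tensorProdFam fun t => f (e (Sum.inl (b, t)))) *
          (1 - T)).trace := by
      rw [mul_sub, mul_sub, Matrix.trace_sub, Matrix.trace_sub, hlift f fun p => hA _ (hf p),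
        mul_one, mul_one, (isState_tensorProdFam fun p => hA _ (hf p)).2,
        (isState_tensorProdFam hst).2]
    rw [h1, hT1, re_trace_tensorProdFam_mul_conjDiag fun b => (hst b).1.1]
    refine sum_indicator_mul_prod_le (q := fun b i =>
      ((Yᴴ * (tensorProdFam fun t => f (e (Sum.inl (b, t)))) * Y) i i).re)
      (u := fun i => s * (t - h i))
      (fun b i => re_conj_diag_nonneg (hst b).1 Y i) (fun x hx => ?_) fun b => ?_
    · have h2 : ∑ b, (h (x b) - t) < 0 := not_le.1 hx
      have h3 : ∑ b, s * (t - h (x b)) = s * -∑ b, (h (x b) - t) := by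
        rw [← Finset.sum_neg_distrib, Finset.mul_sum]
        exact Finset.sum_congr rfl fun b _ => by ring
      rw [h3]
      exact mul_nonneg hs.le (by linarith)
    · refine htilt _ (fun i => re_conj_diag_nonneg (hst b).1 Y i) ?_ ?_
      · have h2 : (Yᴴ * (tensorProdFam fun t => f (e (Sum.inl (b, t)))) * Y).trace = 1 := by
          rw [Matrix.trace_mul_comm, ← mul_assoc, hY, one_mul, (hst b).2]
        rw [← Complex.one_re, ← h2, Matrix.trace, Complex.re_sum]
        rfl
      · rw [← re_trace_mul_conjDiag]
        exact hmean _ ⟨_, fun t => hf _, rfl⟩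
  · rintro _ ⟨σ, hσ, rfl⟩
    have hst := isState_tensorPow (hB σ hσ) k
    have h1 := congrArg Complex.re (hlift (fun _ => σ) fun _ => hB σ hσ)
    refine h1.le.trans ?_
    have h2 := re_trace_tensorProdFam_mul_conjDiag (m := m) (Y := Y)
      (f := fun _ => tensorPow σ k) (fun _ => hst.1.1) fun x => if G x then 1 else 0
    refine h2.le.trans ?_
    refine sum_indicator_mul_prod_le (q := fun _ i => ((Yᴴ * tensorPow σ k * Y) i i).re)
      (u := fun i => h i - t) (fun b i => re_conj_diag_nonneg hst.1 Y i) (fun x hx => hx)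
      fun b => ?_
    have h3 := mul_le_mul_of_nonneg_right (hexp σ hσ) (Real.exp_pos (-t)).le
    refine le_trans (le_of_eq ?_) h3
    rw [Finset.sum_mul]
    exact Finset.sum_congr rfl fun i _ => by rw [sub_eq_add_neg, Real.exp_add]; exact (mul_assoc _ _ _).symm

end Achievability

section Errors

open Matrix

variable {κ : Type*} [Fintype κ] [DecidableEq κ] {A B : Set (Matrix κ κ ℂ)}

lemma typeII_le (hB : ∀ σ ∈ B, IsState σ) (hBne : B.Nonempty) {ε b : ℝ} {E : Matrix κ κ ℂ}
    (hE : E.PosSemidef) (hE' : (1 - E).PosSemidef)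
    (h1 : ∀ ρ ∈ A, (ρ * (1 - E)).trace.re ≤ ε) (h2 : ∀ σ ∈ B, (σ * E).trace.re ≤ b) :
    typeII A B ε ≤ b := by
  have hmem : sSup {x : ℝ | ∃ σ ∈ B, x = (σ * E).trace.re} ∈
      {b : ℝ | ∃ E : Matrix κ κ ℂ, E.PosSemidef ∧ (1 - E).PosSemidef ∧
        (∀ ρ ∈ A, (ρ * (1 - E)).trace.re ≤ ε) ∧
        b = sSup {x : ℝ | ∃ σ ∈ B, x = (σ * E).trace.re}} := ⟨E, hE, hE', h1, rfl⟩
  refine (csInf_le ⟨0, ?_⟩ hmem).trans (csSup_le ?_ ?_)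
  · rintro _ ⟨E, hE, -, -, rfl⟩
    refine Real.sSup_nonneg ?_
    rintro _ ⟨σ, hσ, rfl⟩
    exact re_trace_mul_nonneg (hB σ hσ).1 hE
  · exact ⟨_, hBne.some, hBne.some_mem, rfl⟩
  · rintro _ ⟨σ, hσ, rfl⟩
    exact h2 σ hσ

lemma exists_test_of_typeII_lt (hB : ∀ σ ∈ B, IsState σ) {ε b : ℝ} (hε : 0 ≤ ε)
    (h : typeII A B ε < b) : ∃ E : Matrix κ κ ℂ, E.PosSemidef ∧ (1 - E).PosSemidef ∧
      (∀ ρ ∈ A, (ρ * (1 - E)).trace.re ≤ ε) ∧ ∀ σ ∈ B, (σ * E).trace.re ≤ b := by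
  have hne : {b : ℝ | ∃ E : Matrix κ κ ℂ, E.PosSemidef ∧ (1 - E).PosSemidef ∧
      (∀ ρ ∈ A, (ρ * (1 - E)).trace.re ≤ ε) ∧
      b = sSup {x : ℝ | ∃ σ ∈ B, x = (σ * E).trace.re}}.Nonempty :=
    ⟨_, 1, Matrix.PosSemidef.one, by rw [sub_self]; exact Matrix.PosSemidef.zero,
      fun ρ _ => by simpa using hε, rfl⟩
  obtain ⟨_, ⟨E, hE, hE', h1, rfl⟩, h2⟩ := exists_lt_of_csInf_lt hne h
  refine ⟨E, hE, hE', h1, fun σ hσ => ?_⟩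
  have hmem : (σ * E).trace.re ∈ {x : ℝ | ∃ σ ∈ B, x = (σ * E).trace.re} := ⟨σ, hσ, rfl⟩
  refine (le_csSup ⟨1, ?_⟩ hmem).trans h2.le
  rintro _ ⟨σ, hσ, rfl⟩
  have h3 := re_trace_mul_nonneg (hB σ hσ).1 hE'
  rw [mul_sub, mul_one, Matrix.trace_sub, (hB σ hσ).2, Complex.sub_re, Complex.one_re] at h3
  linarith

end Errors

section Exponents

open Matrix

lemma coe_le_negLog {x y : ℝ} (h : x ≤ Real.exp (-y)) : (y : EReal) ≤ negLog x := by
  unfold negLog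
  split_ifs with hx
  · exact le_top
  · have h1 := Real.log_le_log (not_le.1 hx) h
    rw [Real.log_exp] at h1
    exact EReal.coe_le_coe_iff.2 (by linarith)

lemma lt_exp_of_coe_lt_negLog {x y : ℝ} (h : (y : EReal) < negLog x) : x < Real.exp (-y) := by
  unfold negLog at h
  split_ifs at h with hx
  · exact hx.trans_lt (Real.exp_pos _)
  · rw [EReal.coe_lt_coe_iff] at h
    rw [← Real.log_lt_iff_lt_exp (not_le.1 hx)]
    linarith

lemma cFrac_mul_coe (n : ℕ) (x : ℝ) : cFrac n * (x : EReal) = ((x / n : ℝ) : EReal) := by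
  rw [cFrac, ← EReal.coe_mul, inv_mul_eq_div]

lemma cFrac_nonneg (n : ℕ) : 0 ≤ cFrac n := by
  rw [cFrac, ← EReal.coe_zero, EReal.coe_le_coe_iff]
  positivity

lemma coe_lt_of_lt_cFrac_mul {n : ℕ} (hn : 0 < n) {a : ℝ} {x : EReal}
    (h : (a : EReal) < cFrac n * x) : ((a * n : ℝ) : EReal) < x := by
  by_contra hx
  refine h.not_ge ?_
  refine (mul_le_mul_of_nonneg_left (not_lt.1 hx) (cFrac_nonneg n)).trans ?_
  rw [cFrac_mul_coe, mul_div_cancel_right₀ _ (by exact_mod_cast hn.ne')]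

lemma le_cFrac_mul_of_coe_le {n : ℕ} (hn : 0 < n) {a : ℝ} {x : EReal}
    (h : ((a * n : ℝ) : EReal) ≤ x) : (a : EReal) ≤ cFrac n * x := by
  refine le_trans ?_ (mul_le_mul_of_nonneg_left h (cFrac_nonneg n))
  rw [cFrac_mul_coe, mul_div_cancel_right₀ _ (by exact_mod_cast hn.ne')]

variable {ι : Type*} [Fintype ι] [DecidableEq ι] {A1 B1 : Set (MatC ι)}

lemma isState_of_mem_iidSet (hB : ∀ σ ∈ B1, IsState σ) {n : ℕ} :
    ∀ σ ∈ iidSet B1 n, IsState σ := by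
  rintro _ ⟨σ, hσ, rfl⟩
  exact isState_tensorPow (hB σ hσ) n

lemma tendsto_div_div_natCast {k : ℕ} :
    Tendsto (fun n : ℕ => ((n / k : ℕ) : ℝ) / n) atTop (𝓝 (1 / (k : ℝ))) := by
  have h := (tendsto_nat_floor_mul_div_atTop (R := ℝ) (a := 1 / (k : ℝ)) (by positivity)).comp
    tendsto_natCast_atTop_atTop
  refine h.congr fun n => ?_
  simp only [Function.comp_apply]
  rw [one_div_mul_eq_div, Nat.floor_div_eq_div]

lemma le_steinExponent_of_tests (hB : ∀ σ ∈ B1, IsState σ) (hBne : B1.Nonempty) {k : ℕ}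
    (hk : 0 < k) {r x : ℝ} (hr : 0 ≤ r) (hr1 : r < 1) (hx : 0 < x)
    (H : ∀ m n, m * k ≤ n → ∃ E : MatN ι n, E.PosSemidef ∧
      (1 - E).PosSemidef ∧ (∀ ρ ∈ avSet A1 n, (ρ * (1 - E)).trace.re ≤ r ^ m) ∧
      ∀ σ ∈ iidSet B1 n, (σ * E).trace.re ≤ x ^ m) :
    ((-Real.log x / k : ℝ) : EReal) ≤ steinExponent (avSet A1) (iidSet B1) := by
  refine le_iInf₂ fun ε hε => ?_
  have hlim : Tendsto (fun n : ℕ => ((((n / k : ℕ) : ℝ) / n * (-Real.log x) : ℝ) : EReal)) atTop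
      (𝓝 ((-Real.log x / k : ℝ) : EReal)) := by
    rw [EReal.tendsto_coe]
    have h := (tendsto_div_div_natCast (k := k)).mul_const (-Real.log x)
    rwa [one_div_mul_eq_div] at h
  rw [← hlim.liminf_eq]
  refine liminf_le_liminf ?_
  have hev : ∀ᶠ n : ℕ in atTop, r ^ (n / k) < ε :=
    ((tendsto_pow_atTop_nhds_zero_of_lt_one hr hr1).comp
      (Nat.tendsto_div_const_atTop hk.ne')).eventually_lt_const hε.1
  filter_upwards [hev] with n hn
  obtain ⟨E, hE, hE', h1, h2⟩ := H (n / k) n (Nat.div_mul_le_self n k)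
  have h3 : typeII (avSet A1 n) (iidSet B1 n) ε ≤ x ^ (n / k) :=
    typeII_le (isState_of_mem_iidSet hB) ⟨_, hBne.some, hBne.some_mem, rfl⟩ hE hE'
      (fun ρ hρ => (h1 ρ hρ).trans hn.le) h2
  have h4 : (((n / k : ℕ) * -Real.log x : ℝ) : EReal) ≤
      negLog (typeII (avSet A1 n) (iidSet B1 n) ε) := by
    refine coe_le_negLog (h3.trans (le_of_eq ?_))
    rw [mul_neg, neg_neg, ← Real.log_pow, Real.exp_log (pow_pos hx _)]
  refine le_trans (le_of_eq ?_) (mul_le_mul_of_nonneg_left h4 (cFrac_nonneg n))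
  rw [cFrac_mul_coe, div_mul_eq_mul_div]

lemma le_steinExponent_of_lt_relEnt (hA : ∀ ρ ∈ A1, IsState ρ) (hAne : A1.Nonempty)
    (hAcomp : IsCompact A1) (hB : ∀ σ ∈ B1, IsState σ) (hBne : B1.Nonempty)
    (μ : Measure ↥B1) [IsProbabilityMeasure μ] {k : ℕ} (hk : 0 < k) {c : ℝ} (hc : 0 < c)
    (hμ : ∀ σ ∈ B1, ∀ E : MatN ι k, E.PosSemidef →
      (tensorPow σ k * E).trace.re ≤ c * (iidMix μ k * E).trace.re)
    {R : ℝ} (hR : ∀ ρ ∈ convexHull ℝ (avSet A1 k), (R : EReal) < relEnt ρ (iidMix μ k)) :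
    (((R - Real.log (2 * (k + 1) ^ Fintype.card (ι × ι)) - 1 - Real.log c) / k : ℝ) : EReal) ≤
      steinExponent (avSet A1) (iidSet B1) := by
  have hω := isState_iidMix hB μ k
  obtain ⟨Y, h, hY, hY', hexp, hmean⟩ := exists_uniform_logTest hω
    (fun ρ hρ => isState_of_mem_convexHull_avSet hA hρ)
    (convexHull_nonempty_iff.2 (avSet_nonempty hAne k))
    (isCompact_convexHull_of_finiteDimensional (isCompact_avSet hAcomp k))
    (convex_convexHull ℝ _) hR
  have hcard := (card_eigenvalues_le_finrank (permInvariant ι k) hω.1.1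
    (iidMix_mem_permInvariant μ k)).trans (finrank_permInvariant_le k)
  generalize (Finset.univ.image hω.1.1.eigenvalues).card = v at hmean hcard
  have hlog : Real.log (2 * v) ≤ Real.log (2 * (k + 1) ^ Fintype.card (ι × ι)) := by
    rcases Nat.eq_zero_or_pos v with rfl | hv
    · simp only [Nat.cast_zero, mul_zero, Real.log_zero]
      refine Real.log_nonneg ?_
      have : (1 : ℝ) ≤ (k + 1) ^ Fintype.card (ι × ι) := one_le_pow₀ (by linarith [k.cast_nonneg (α := ℝ)])
      linarith
    · have hv' : (0 : ℝ) < v := by exact_mod_cast hv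
      exact Real.log_le_log (by positivity)
        (mul_le_mul_of_nonneg_left (by exact_mod_cast hcard) zero_le_two)
  obtain ⟨r, hr, hr1, H⟩ := exists_test_of_logTest hA hB hY' (h := h)
    (t := R - Real.log (2 * (k + 1) ^ Fintype.card (ι × ι)) - 1) (c := c) one_pos
    (fun ρ hρ => by linarith [hmean ρ (subset_convexHull ℝ _ hρ)]) fun σ hσ => by
      have h1 := hμ σ hσ (conjDiag Y fun i => Real.exp (h i))
        (conjDiag_posSemidef _ fun i => (Real.exp_pos _).le)
      rw [re_trace_mul_conjDiag, re_trace_mul_conjDiag] at h1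
      refine h1.trans (mul_le_of_le_one_right hc.le (le_trans (le_of_eq ?_) hexp))
      exact Finset.sum_congr rfl fun i _ => mul_comm _ _
  have h1 := le_steinExponent_of_tests hB hBne hk hr hr1 (mul_pos hc (Real.exp_pos _)) H
  rwa [Real.log_mul hc.ne' (Real.exp_pos _).ne', Real.log_exp, neg_add_rev, neg_neg,
    ← sub_eq_add_neg] at h1

/-- Every asymptotic lower bound on the Stein exponent is one for the regularised relative
entropy to a mixture of i.i.d. states. -/
lemma eventually_le_regularized (hA : ∀ ρ ∈ A1, IsState ρ) (hB : ∀ σ ∈ B1, IsState σ)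
    (μ : Measure ↥B1) [IsProbabilityMeasure μ] {a : ℝ}
    (ha : (a : EReal) < steinExponent (avSet A1) (iidSet B1)) :
    ∀ᶠ n : ℕ in atTop,
      (a : EReal) ≤ cFrac n * ⨅ ρn ∈ convexHull ℝ (avSet A1 n), relEnt ρn (iidMix μ n) := by
  suffices h : ∀ᶠ n : ℕ in atTop, ∀ ρ ∈ convexHull ℝ (avSet A1 n),
      ((a * n : ℝ) : EReal) ≤ relEnt ρ (iidMix μ n) by
    filter_upwards [h, eventually_gt_atTop 0] with n hn hn0
    exact le_cFrac_mul_of_coe_le hn0 (le_iInf₂ hn)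
  rcases lt_or_ge a 0 with ha0 | ha0
  · have hev : ∀ᶠ n : ℕ in atTop, a * n ≤ -1 :=
      (tendsto_natCast_atTop_atTop.const_mul_atTop_of_neg ha0).eventually_le_atBot (-1)
    filter_upwards [hev] with n hn ρ hρ
    exact (EReal.coe_le_coe_iff.2 hn).trans
      (neg_one_le_relEnt (isState_of_mem_convexHull_avSet hA hρ) (isState_iidMix hB μ n))
  obtain ⟨b, hab, hb⟩ := EReal.lt_iff_exists_real_btwn.1 ha
  rw [EReal.coe_lt_coe_iff] at hab
  have hb0 : 0 < b := ha0.trans_lt hab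
  let ε := (b - a) / (8 * b)
  have hε0 : 0 < ε := div_pos (by linarith) (by linarith)
  have hε1 : ε ≤ 1 / 8 := by
    rw [div_le_iff₀ (by linarith)]
    linarith
  have hεb : (1 - 4 * ε) * b = (a + b) / 2 := by
    simp only [ε]
    field_simp
    ring
  have hev1 := eventually_lt_of_lt_liminf
    (hb.trans_le (iInf₂_le ε ⟨hε0, by linarith⟩))
  have hbn : Tendsto (fun n : ℕ => b * (n : ℝ)) atTop atTop :=
    tendsto_natCast_atTop_atTop.const_mul_atTop hb0
  have hev2 : ∀ᶠ n : ℕ in atTop, Real.exp (-(b * n)) ≤ ε :=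
    ((Real.tendsto_exp_neg_atTop_nhds_zero.comp hbn).eventually_le_const hε0)
  have hev3 : ∀ᶠ n : ℕ in atTop, 1 - (1 - 4 * ε) * Real.log ε ≤ (b - a) / 2 * n :=
    (tendsto_natCast_atTop_atTop.const_mul_atTop (by linarith)).eventually_ge_atTop _
  filter_upwards [hev1, hev2, hev3, eventually_gt_atTop 0] with n h1 h2 h3 hn ρ hρ
  obtain ⟨E, hE, hE', hI, hII⟩ := exists_test_of_typeII_lt (isState_of_mem_iidSet hB) hε0.le
    (lt_exp_of_coe_lt_negLog (coe_lt_of_lt_cFrac_mul hn h1))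
  have hI' : (ρ * (1 - E)).trace.re ≤ ε := by
    let φ : MatN ι n →ₗ[ℝ] ℝ := Complex.reLm ∘ₗ
      (Matrix.traceLinearMap (Fin n → ι) ℝ ℂ) ∘ₗ LinearMap.mulRight ℝ (1 - E)
    exact convexHull_min (t := {ρ | φ ρ ≤ ε}) hI (convex_halfSpace_le φ.isLinear ε) hρ
  have hII' : (iidMix μ n * E).trace.re ≤ Real.exp (-(b * n)) := by
    rw [re_trace_iidMix_mul hB]
    refine (integral_mono (integrable_re_trace_tensorPow_mul hB μ n E)
      (integrable_const (Real.exp (-(b * n)))) fun σ => hII _ ⟨σ, σ.2, rfl⟩).trans ?_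
    simp
  refine le_trans (EReal.coe_le_coe_iff.2 ?_)
    (le_relEnt_of_test (isState_of_mem_convexHull_avSet hA hρ) (isState_iidMix hB μ n) hE hE'
      (Real.exp_pos _) h2 hI' hII')
  rw [Real.log_exp]
  have h4 : (1 - 4 * ε) * (b * n) = (a + b) / 2 * n := by rw [← mul_assoc, hεb]
  linarith

lemma tendsto_log_polynomial_div {C : ℝ} (hC : 0 < C) (D : ℕ) :
    Tendsto (fun n : ℕ => Real.log (C * (n + 1) ^ D) / n) atTop (𝓝 0) := by
  have h0 : Tendsto (fun x : ℝ => Real.log (x + 1) / x) atTop (𝓝 0) := by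
    have h1 : Tendsto (fun x : ℝ => Real.log (x + 1) / (x + 1) * ((x + 1) / x)) atTop
        (𝓝 (0 * (1 + 0))) := by
      refine Tendsto.mul ?_ ?_
      · exact (Real.isLittleO_log_id_atTop.tendsto_div_nhds_zero).comp
          (tendsto_atTop_add_const_right _ _ tendsto_id)
      · refine (tendsto_const_nhds.add tendsto_inv_atTop_zero).congr' ?_
        filter_upwards [eventually_gt_atTop 0] with x hx
        field_simp
    rw [zero_mul] at h1
    refine h1.congr' ?_
    filter_upwards [eventually_gt_atTop 0] with x hx
    field_simp
  have h2 : Tendsto (fun n : ℕ => Real.log C / n + D * (Real.log ((n : ℝ) + 1) / n)) atTop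
      (𝓝 (0 + D * 0)) :=
    (tendsto_const_div_atTop_nhds_zero_nat _).add
      ((h0.comp tendsto_natCast_atTop_atTop).const_mul _)
  rw [mul_zero, add_zero] at h2
  refine h2.congr fun n => ?_
  rw [Real.log_mul hC.ne' (by positivity), Real.log_pow]
  ring

/-- For a universal mixing measure the regularised relative entropy does not exceed the Stein
exponent. -/
lemma eventually_regularized_le (hA : ∀ ρ ∈ A1, IsState ρ) (hAne : A1.Nonempty)
    (hAcomp : IsCompact A1) (hB : ∀ σ ∈ B1, IsState σ) (hBne : B1.Nonempty)
    (μ : Measure ↥B1) [IsProbabilityMeasure μ] {C : ℝ} {D : ℕ} (hC : 0 < C)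
    (hμ : ∀ n, ∀ σ ∈ B1, ∀ E : MatN ι n, E.PosSemidef →
      (tensorPow σ n * E).trace.re ≤ C * (n + 1) ^ D * (iidMix μ n * E).trace.re) {a : ℝ}
    (ha : steinExponent (avSet A1) (iidSet B1) < (a : EReal)) :
    ∀ᶠ n : ℕ in atTop,
      cFrac n * ⨅ ρn ∈ convexHull ℝ (avSet A1 n), relEnt ρn (iidMix μ n) ≤ (a : EReal) := by
  obtain ⟨a', ha', haa⟩ := EReal.lt_iff_exists_real_btwn.1 ha
  rw [EReal.coe_lt_coe_iff] at haa
  have herr := ((tendsto_log_polynomial_div zero_lt_two (Fintype.card (ι × ι))).add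
    (tendsto_const_div_atTop_nhds_zero_nat (1 : ℝ))).add (tendsto_log_polynomial_div hC D)
  rw [add_zero, add_zero] at herr
  filter_upwards [herr.eventually_lt_const (sub_pos.2 haa), eventually_gt_atTop 0] with n hn hn0
  by_contra h
  have h1 := coe_lt_of_lt_cFrac_mul hn0 (not_le.1 h)
  have h2 := le_steinExponent_of_lt_relEnt hA hAne hAcomp hB hBne μ hn0 (by positivity) (hμ n)
    fun ρ hρ => h1.trans_le (iInf₂_le ρ hρ)
  have h3 := h2.trans_lt ha'
  rw [EReal.coe_lt_coe_iff, sub_div, sub_div, sub_div,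
    mul_div_cancel_right₀ _ (by exact_mod_cast hn0.ne')] at h3
  linarith

end Exponents

/-- **Arbitrarily varying null versus composite i.i.d. alternative.**
`Stein(𝒜₁^{av}‖ℬ₁^{iid}) = min*_{μ∈𝒫(ℬ₁)} lim_n (1/n) inf_{ρ_n∈co(𝒜₁^{⊗n,av})}
  D(ρ_n‖∫dμ(σ) σ^{⊗n})`. -/
theorem composite_av_vs_composite_iid (d : ℕ)
    (A1 B1 : Set (MatC (Fin d)))
    (hA_states : ∀ ρ ∈ A1, IsState ρ) (hA_ne : A1.Nonempty) (hA_closed : IsClosed A1)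
    (hB_states : ∀ σ ∈ B1, IsState σ) (hB_ne : B1.Nonempty) (hB_closed : IsClosed B1) :
    ∃ S : EReal,
      steinExponent (avSet A1) (iidSet B1) = S ∧
      (∃ μ : Measure ↥B1, IsProbabilityMeasure μ ∧
        Filter.Tendsto
          (fun n : ℕ => cFrac n * ⨅ ρn ∈ convexHull ℝ (avSet A1 n), relEnt ρn (iidMix μ n))
          Filter.atTop (nhds S)) ∧
      (∀ μ : Measure ↥B1, IsProbabilityMeasure μ → ∀ L : EReal,
        Filter.Tendsto
          (fun n : ℕ => cFrac n * ⨅ ρn ∈ convexHull ℝ (avSet A1 n), relEnt ρn (iidMix μ n))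
          Filter.atTop (nhds L) → S ≤ L) := by
  have hA_comp := isCompact_of_isClosed_of_isState hA_states hA_closed
  have hB_comp := isCompact_of_isClosed_of_isState hB_states hB_closed
  refine ⟨_, rfl, ?_, fun μ _ L hL => ?_⟩
  · obtain ⟨μ, hμ, C, D, hC, hdom⟩ := exists_universal_measure hB_states hB_ne hB_comp
    refine ⟨μ, hμ, tendsto_order.2 ⟨fun x hx => ?_, fun x hx => ?_⟩⟩
    · obtain ⟨a, hxa, ha⟩ := EReal.lt_iff_exists_real_btwn.1 hx
      filter_upwards [eventually_le_regularized hA_states hB_states μ ha] with n hn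
      exact hxa.trans_le hn
    · obtain ⟨a, ha, hax⟩ := EReal.lt_iff_exists_real_btwn.1 hx
      filter_upwards [eventually_regularized_le hA_states hA_ne hA_comp hB_states hB_ne μ hC hdom
        ha] with n hn
      exact hn.trans_lt hax
  · refine EReal.ge_of_forall_gt_iff_ge.1 fun a ha => ?_
    exact ge_of_tendsto hL (eventually_le_regularized hA_states hB_states μ ha)

end QSanov
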